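/- arXiv:1312.7781 — 2 statements merged into one kernel-verified Lean document; each statement's English description precedes it below -/
import Mathlib

section
/- (Lattice failure) Let w be an isometry of E = ℝⁿ. The interval [1,w] (with its betweenness partial order) fails to be a lattice if and only if w is hyperbolic and its move-set has dimension at least 2; for all other w (namely w elliptic, or w hyperbolic with move-set of dimension at most 1), the interval [1,w] is a lattice. -/
open scoped RealInnerProductSpace

noncomputable section

/-- `n`-dimensional euclidean space `E = ℝⁿ` (also used as the vector space `V` of
translations). -/
abbrev Euc (n : ℕ) := EuclideanSpace ℝ (Fin n)

/-- An isometry of `E`: a surjective distance-preserving map of `E` to itself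
(such a map is automatically an affine bijection). -/
abbrev Iso (n : ℕ) := Euc n ≃ᵢ Euc n

/-- The move-set `Mov(w) = { w(x) - x : x ∈ E } ⊆ V`. -/
def MovSet (n : ℕ) (w : Iso n) : Set (Euc n) := {v | ∃ x, w x - x = v}

/-- The fix-set `Fix(w) = { x ∈ E : w(x) = x }`. -/
def FixSet (n : ℕ) (w : Iso n) : Set (Euc n) := {x | w x = x}

/-- A reflection: a nontrivial isometry fixing pointwise an affine hyperplane,
i.e. a nonempty affine subspace of codimension one. -/
def IsReflection (n : ℕ) (r : Iso n) : Prop :=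
  r ≠ 1 ∧ ∃ H : AffineSubspace ℝ (Euc n), (H : Set (Euc n)).Nonempty ∧
    Module.finrank ℝ H.direction + 1 = n ∧ ∀ x ∈ H, r x = x

/-- The reflection length `ℓ(w)`: the least `k` such that `w` is a product of `k`
reflections. -/
def reflLen (n : ℕ) (w : Iso n) : ℕ :=
  sInf {k | ∃ l : List (Iso n), l.length = k ∧ (∀ r ∈ l, IsReflection n r) ∧ l.prod = w}

/-- `u` lies in the interval `[1, w]`:  `ℓ(u) + ℓ(u⁻¹w) = ℓ(w)`. -/
def inInterval (n : ℕ) (w u : Iso n) : Prop :=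
  reflLen n u + reflLen n (u⁻¹ * w) = reflLen n w

/-- The betweenness partial order on the interval `[1, w]`:
`u ≤ v` iff `ℓ(u) + ℓ(u⁻¹v) + ℓ(v⁻¹w) = ℓ(w)`. -/
def intervalLE (n : ℕ) (w u v : Iso n) : Prop :=
  reflLen n u + reflLen n (u⁻¹ * v) + reflLen n (v⁻¹ * w) = reflLen n w

/-- The set of directions `Dir(S) = { m - m' : m, m' ∈ S }` of a subset `S`. -/
def dirSet (n : ℕ) (S : Set (Euc n)) : Set (Euc n) := {d | ∃ m ∈ S, ∃ m' ∈ S, d = m - m'}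

/-- `α` is a root of the reflection `r`: a nonzero vector orthogonal to the
direction space of the fixed hyperplane of `r`. -/
def IsRoot (n : ℕ) (r : Iso n) (α : Euc n) : Prop :=
  α ≠ 0 ∧ ∀ x y : Euc n, r x = x → r y = y → ⟪α, y - x⟫ = 0

section LinearIsometries

variable {V : Type*} [NormedAddCommGroup V] [InnerProductSpace ℝ V]

/-- The move-space `im (A - 1)` of a linear isometry `A`. -/
def moveSpace (A : V ≃ₗᵢ[ℝ] V) : Submodule ℝ V :=
  LinearMap.range ((A.toLinearEquiv : V →ₗ[ℝ] V) - LinearMap.id)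

lemma mem_moveSpace {A : V ≃ₗᵢ[ℝ] V} {v : V} : v ∈ moveSpace A ↔ ∃ x, A x - x = v := by
  simp [moveSpace]

lemma sub_mem_moveSpace (A : V ≃ₗᵢ[ℝ] V) (x : V) : A x - x ∈ moveSpace A :=
  mem_moveSpace.2 ⟨x, rfl⟩

lemma moveSpace_eq_bot {A : V ≃ₗᵢ[ℝ] V} : moveSpace A = ⊥ ↔ A = 1 := by
  rw [Submodule.eq_bot_iff]
  refine ⟨fun h ↦ LinearIsometryEquiv.ext fun x ↦ sub_eq_zero.1 (h _ (sub_mem_moveSpace A x)), ?_⟩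
  rintro rfl v hv
  obtain ⟨x, rfl⟩ := mem_moveSpace.1 hv
  simp

lemma moveSpace_mul_le (A B : V ≃ₗᵢ[ℝ] V) : moveSpace (A * B) ≤ moveSpace A ⊔ moveSpace B := by
  intro v hv
  obtain ⟨x, rfl⟩ := mem_moveSpace.1 hv
  have := Submodule.add_mem_sup (sub_mem_moveSpace A (B x)) (sub_mem_moveSpace B x)
  simpa using this

lemma moveSpace_inv (A : V ≃ₗᵢ[ℝ] V) : moveSpace A⁻¹ = moveSpace A := by
  have key : ∀ B : V ≃ₗᵢ[ℝ] V, moveSpace B⁻¹ ≤ moveSpace B := by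
    intro B v hv
    obtain ⟨x, rfl⟩ := mem_moveSpace.1 hv
    have h := neg_mem (sub_mem_moveSpace B (B⁻¹ x))
    have e : B (B⁻¹ x) = x := B.apply_symm_apply x
    simpa [e] using h
  exact le_antisymm (key A) (by simpa using key A⁻¹)

/-- The orthogonal complement of the move-space is the fixed space. -/
lemma mem_moveSpace_orthogonal {A : V ≃ₗᵢ[ℝ] V} {x : V} : x ∈ (moveSpace A)ᗮ ↔ A x = x := by
  rw [Submodule.mem_orthogonal]
  constructor
  · intro h
    have h1 := h _ (sub_mem_moveSpace A x)
    rw [← sub_eq_zero, ← inner_self_eq_zero (𝕜 := ℝ)]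
    rw [inner_sub_left, real_inner_self_eq_norm_sq] at h1
    simp only [inner_sub_left, inner_sub_right, real_inner_self_eq_norm_sq, A.norm_map,
      real_inner_comm x (A x)]
    rw [real_inner_comm] at h1
    linarith
  · intro h v hv
    obtain ⟨y, rfl⟩ := mem_moveSpace.1 hv
    rw [inner_sub_left]
    nth_rw 1 [← h]
    simp

/-- The linear reflection with root `α`. -/
abbrev rootReflection (α : V) : V ≃ₗᵢ[ℝ] V := (ℝ ∙ α)ᗮ.reflection

lemma rootReflection_apply (α x : V) :
    rootReflection α x = x - (2 * ⟪α, x⟫ / ‖α‖ ^ 2) • α := by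
  rw [Submodule.reflection_orthogonal_apply, Submodule.reflection_singleton_apply]
  simp only [RCLike.ofReal_real_eq_id, id]
  module

lemma moveSpace_rootReflection_le (α : V) : moveSpace (rootReflection α) ≤ ℝ ∙ α := by
  intro v hv
  obtain ⟨x, rfl⟩ := mem_moveSpace.1 hv
  rw [rootReflection_apply, Submodule.mem_span_singleton]
  exact ⟨-(2 * ⟪α, x⟫ / ‖α‖ ^ 2), by module⟩

lemma moveSpace_rootReflection (α : V) : moveSpace (rootReflection α) = ℝ ∙ α := by
  refine le_antisymm (moveSpace_rootReflection_le α) ?_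
  rw [Submodule.span_singleton_le_iff_mem, mem_moveSpace]
  refine ⟨-(1 / 2 : ℝ) • α, ?_⟩
  rw [map_smul, Submodule.reflection_orthogonalComplement_singleton_eq_neg]
  module

variable [FiniteDimensional ℝ V]

lemma finrank_moveSpace_mul_le (A B : V ≃ₗᵢ[ℝ] V) :
    Module.finrank ℝ (moveSpace (A * B)) ≤
      Module.finrank ℝ (moveSpace A) + Module.finrank ℝ (moveSpace B) :=
  (Submodule.finrank_mono (moveSpace_mul_le A B)).trans
    (Submodule.finrank_add_le_finrank_add_finrank _ _)

lemma finrank_moveSpace_rootReflection_mul_le (α : V) (A : V ≃ₗᵢ[ℝ] V) :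
    Module.finrank ℝ (moveSpace (rootReflection α * A)) ≤ Module.finrank ℝ (moveSpace A) + 1 := by
  have := finrank_moveSpace_mul_le (rootReflection α) A
  rw [moveSpace_rootReflection] at this
  have : Module.finrank ℝ (ℝ ∙ α) ≤ 1 := (finrank_span_le_card {α}).trans (by simp)
  omega

lemma finrank_moveSpace_le_rootReflection_mul (α : V) (A : V ≃ₗᵢ[ℝ] V) :
    Module.finrank ℝ (moveSpace A) ≤ Module.finrank ℝ (moveSpace (rootReflection α * A)) + 1 := by
  have := finrank_moveSpace_rootReflection_mul_le α (rootReflection α * A)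
  rwa [← mul_assoc, Submodule.reflection_mul_reflection, one_mul] at this

/-- Multiplying by a reflection whose root is in the move-space shrinks the move-space. -/
lemma finrank_moveSpace_rootReflection_mul {α : V} {A : V ≃ₗᵢ[ℝ] V} (hα : α ≠ 0)
    (h : α ∈ moveSpace A) :
    Module.finrank ℝ (moveSpace (rootReflection α * A)) + 1 = Module.finrank ℝ (moveSpace A) := by
  refine le_antisymm ?_ (finrank_moveSpace_le_rootReflection_mul α A)
  obtain ⟨y, hy⟩ := mem_moveSpace.1 h
  have hlt : (moveSpace A)ᗮ < (moveSpace (rootReflection α * A))ᗮ := by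
    refine lt_of_le_of_ne (fun x hx ↦ ?_) fun heq ↦ ?_
    · rw [mem_moveSpace_orthogonal]
      have h1 := mem_moveSpace_orthogonal.1 hx
      rw [LinearIsometryEquiv.coe_mul, Function.comp_apply, h1,
        Submodule.reflection_eq_self_iff, Submodule.mem_orthogonal_singleton_iff_inner_right]
      exact (Submodule.mem_orthogonal _ _).1 hx _ h
    · have : y ∈ (moveSpace (rootReflection α * A))ᗮ := by
        rw [mem_moveSpace_orthogonal, LinearIsometryEquiv.coe_mul, Function.comp_apply, ← hy]
        exact Submodule.reflection_sub (A.norm_map y)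
      rw [← heq, mem_moveSpace_orthogonal] at this
      exact hα (by rw [← hy, this, sub_self])
  have h1 := Submodule.finrank_lt_finrank_of_lt hlt
  have h2 := (moveSpace A).finrank_add_finrank_orthogonal
  have h3 := (moveSpace (rootReflection α * A)).finrank_add_finrank_orthogonal
  omega

/-- A linear isometry with one-dimensional move-space is a reflection. -/
lemma eq_rootReflection {A : V ≃ₗᵢ[ℝ] V} (hA : Module.finrank ℝ (moveSpace A) ≤ 1) {α : V}
    (hα : α ≠ 0) (h : α ∈ moveSpace A) : A = rootReflection α := by
  have h1 := finrank_moveSpace_rootReflection_mul hα h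
  have h2 : Module.finrank ℝ (moveSpace (rootReflection α * A)) = 0 := by omega
  rw [Submodule.finrank_eq_zero, moveSpace_eq_bot] at h2
  rw [← one_mul A, ← Submodule.reflection_mul_reflection (K := (ℝ ∙ α)ᗮ), mul_assoc, h2, mul_one]

/-- Every hyperplane `φᗮ` of the move-space of `A` is the move-space of `A` times a reflection. -/
lemma exists_moveSpace_mul_rootReflection {A : V ≃ₗᵢ[ℝ] V} {φ : V} (hφ : φ ≠ 0)
    (h : φ ∈ moveSpace A) : ∃ β ∈ moveSpace A, β ≠ 0 ∧
      moveSpace (A * rootReflection β) = moveSpace A ⊓ (ℝ ∙ φ)ᗮ ∧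
      Module.finrank ℝ (moveSpace (A * rootReflection β)) + 1 = Module.finrank ℝ (moveSpace A) := by
  have hβ : A⁻¹ φ - φ ∈ moveSpace A := moveSpace_inv A ▸ sub_mem_moveSpace A⁻¹ φ
  have hne : A⁻¹ φ - φ ≠ 0 := by
    intro h0
    have h1 : φ ∈ (moveSpace A)ᗮ := by
      rw [← moveSpace_inv, mem_moveSpace_orthogonal]
      exact sub_eq_zero.1 h0
    exact hφ (inner_self_eq_zero (𝕜 := ℝ).1 ((Submodule.mem_orthogonal _ _).1 h1 φ h))
  set β := A⁻¹ φ - φ with hβdef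
  have hle : moveSpace (A * rootReflection β) ≤ moveSpace A ⊓ (ℝ ∙ φ)ᗮ := by
    refine le_inf ((moveSpace_mul_le _ _).trans (sup_le le_rfl ?_)) fun v hv ↦ ?_
    · rwa [moveSpace_rootReflection, Submodule.span_singleton_le_iff_mem]
    · obtain ⟨x, rfl⟩ := mem_moveSpace.1 hv
      rw [Submodule.mem_orthogonal_singleton_iff_inner_right, inner_sub_right]
      have e1 : rootReflection β (A⁻¹ φ) = φ := Submodule.reflection_sub (A⁻¹.norm_map φ)
      have e2 : A (A⁻¹ φ) = φ := A.apply_symm_apply φ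
      have e3 : ⟪φ, A (rootReflection β x)⟫ = ⟪φ, x⟫ := by
        nth_rw 1 [← e2]
        rw [A.inner_map_map]
        nth_rw 2 [← e1]
        rw [← (rootReflection β).inner_map_map, Submodule.reflection_reflection]
      simp [e3]
  have hlt : moveSpace A ⊓ (ℝ ∙ φ)ᗮ < moveSpace A := by
    refine lt_of_le_of_ne inf_le_left fun heq ↦ hφ ?_
    have := (inf_eq_left.1 heq) h
    rw [Submodule.mem_orthogonal_singleton_iff_inner_right] at this
    exact inner_self_eq_zero.1 this
  have h1 := Submodule.finrank_lt_finrank_of_lt hlt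
  have h2 := finrank_moveSpace_mul_le (A * rootReflection β) (rootReflection β)
  rw [mul_assoc, Submodule.reflection_mul_reflection, mul_one, moveSpace_rootReflection] at h2
  have h3 := finrank_span_singleton (K := ℝ) hne
  have h4 := Submodule.finrank_mono hle
  exact ⟨β, hβ, hne, Submodule.eq_of_le_of_finrank_le hle (by omega), by omega⟩

/-- If the move-spaces of `B` and `C` are independent, then `B` is determined by the product
`B * C` and its move-space. -/
lemma eq_of_mul_eq_mul_of_disjoint {B C B' C' : V ≃ₗᵢ[ℝ] V} (h : B * C = B' * C')
    (hd : Disjoint (moveSpace B) (moveSpace C)) (hd' : Disjoint (moveSpace B') (moveSpace C'))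
    (hB : moveSpace B = moveSpace B') : B = B' := by
  have hBB : ∀ x, B (C x) = B' (C' x) := fun x ↦ congrArg (fun A : V ≃ₗᵢ[ℝ] V ↦ A x) h
  let K : Submodule ℝ V := LinearMap.eqLocus (B.toLinearEquiv : V →ₗ[ℝ] V) B'.toLinearEquiv
  have hK : ∀ x, x ∈ K ↔ B x = B' x := fun x ↦ Iff.rfl
  have h1 : (moveSpace B)ᗮ ≤ K := by
    intro x hx
    rw [hK, mem_moveSpace_orthogonal.1 hx, mem_moveSpace_orthogonal.1 (hB ▸ hx)]
  have h2 : (moveSpace C)ᗮ ≤ K := by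
    intro x hx
    have hC := mem_moveSpace_orthogonal.1 hx
    have hC' : C' x = x := by
      rw [← sub_eq_zero]
      refine (Submodule.disjoint_def.1 hd') _ ?_ (sub_mem_moveSpace C' x)
      have e : C' x - x = (B x - x) - (B' (C' x) - C' x) := by
        rw [← hBB, hC]; abel
      rw [e]
      exact sub_mem (hB ▸ sub_mem_moveSpace B x) (sub_mem_moveSpace B' (C' x))
    rw [hK]
    simpa [hC, hC'] using hBB x
  have h3 : Kᗮ = ⊥ := by
    rw [eq_bot_iff, ← hd.eq_bot]
    refine le_inf ?_ ?_
    · simpa using Submodule.orthogonal_le h1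
    · simpa using Submodule.orthogonal_le h2
  rw [Submodule.orthogonal_eq_bot_iff] at h3
  exact LinearIsometryEquiv.ext fun x ↦ (hK x).1 (h3 ▸ Submodule.mem_top)

end LinearIsometries
section Isometries

variable {n : ℕ}

/-- The linear part of an isometry. -/
def linearPart (w : Iso n) : Euc n ≃ₗᵢ[ℝ] Euc n :=
  w.toRealAffineIsometryEquiv.linearIsometryEquiv

lemma linearPart_sub (w : Iso n) (x y : Euc n) : linearPart w (x - y) = w x - w y := by
  have := w.toRealAffineIsometryEquiv.map_vsub x y
  simpa [linearPart] using this

lemma apply_eq_add (w : Iso n) (x y : Euc n) : w x = linearPart w (x - y) + w y := by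
  rw [linearPart_sub]; abel

lemma linearPart_one : linearPart (1 : Iso n) = 1 :=
  LinearIsometryEquiv.ext fun x ↦ by simpa using linearPart_sub (1 : Iso n) x 0

lemma linearPart_mul (u v : Iso n) : linearPart (u * v) = linearPart u * linearPart v :=
  LinearIsometryEquiv.ext fun x ↦ by
    have h1 := linearPart_sub (u * v) x 0
    have h2 := linearPart_sub v x 0
    rw [sub_zero] at h1 h2
    simp [h1, h2, linearPart_sub]

lemma linearPart_inv (u : Iso n) : linearPart u⁻¹ = (linearPart u)⁻¹ :=
  eq_inv_of_mul_eq_one_left (by rw [← linearPart_mul, inv_mul_cancel, linearPart_one])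

lemma iso_ext_of_linearPart {u v : Iso n} (h : linearPart u = linearPart v) {p : Euc n}
    (hp : u p = v p) : u = v :=
  IsometryEquiv.ext fun x ↦ by rw [apply_eq_add u x p, apply_eq_add v x p, h, hp]

/-- The direction space of the move-set of an isometry. -/
def moveDir (w : Iso n) : Submodule ℝ (Euc n) := moveSpace (linearPart w)

/-- The dimension of the move-set of an isometry. -/
def moveDim (w : Iso n) : ℕ := Module.finrank ℝ (moveDir w)

lemma mem_movSet {w : Iso n} (x : Euc n) {v : Euc n} :
    v ∈ MovSet n w ↔ v - (w x - x) ∈ moveDir w := by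
  have key : ∀ y, w y - y - (w x - x) = linearPart w (y - x) - (y - x) := fun y ↦ by
    rw [linearPart_sub]; abel
  constructor
  · rintro ⟨y, rfl⟩
    rw [key]
    exact sub_mem_moveSpace _ _
  · intro h
    obtain ⟨z, hz⟩ := mem_moveSpace.1 h
    refine ⟨z + x, ?_⟩
    have := key (z + x)
    rw [add_sub_cancel_right, hz] at this
    exact sub_left_injective this

lemma apply_sub_mem_movSet (w : Iso n) (x : Euc n) : w x - x ∈ MovSet n w := ⟨x, rfl⟩

lemma vectorSpan_movSet (w : Iso n) : vectorSpan ℝ (MovSet n w) = moveDir w := by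
  rw [vectorSpan_eq_span_vsub_set_right ℝ (apply_sub_mem_movSet w 0)]
  have : (fun v ↦ v -ᵥ (w 0 - 0)) '' MovSet n w = moveDir w := by
    ext v
    simp only [Set.mem_image, mem_movSet 0, vsub_eq_sub, SetLike.mem_coe]
    exact ⟨fun ⟨u, hu, h⟩ ↦ h ▸ hu, fun h ↦ ⟨v + (w 0 - 0), by simpa using h, by abel⟩⟩
  rw [this, Submodule.span_eq]

/-- An isometry is elliptic if it has a fixed point. -/
def IsElliptic (w : Iso n) : Prop := ∃ p, w p = p

lemma zero_mem_movSet {w : Iso n} : 0 ∈ MovSet n w ↔ IsElliptic w := by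
  simp [MovSet, IsElliptic, sub_eq_zero]

lemma isElliptic_iff_apply_sub_mem {w : Iso n} (x : Euc n) :
    IsElliptic w ↔ w x - x ∈ moveDir w := by
  rw [← zero_mem_movSet, mem_movSet x, zero_sub, neg_mem_iff]

lemma IsElliptic.apply_sub_mem {w : Iso n} (h : IsElliptic w) (x : Euc n) :
    w x - x ∈ moveDir w := (isElliptic_iff_apply_sub_mem x).1 h

lemma IsElliptic.inv {w : Iso n} (h : IsElliptic w) : IsElliptic w⁻¹ := by
  obtain ⟨p, hp⟩ := h
  exact ⟨p, by nth_rw 1 [← hp]; exact w.inv_apply_self p⟩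

lemma isElliptic_inv {w : Iso n} : IsElliptic w⁻¹ ↔ IsElliptic w :=
  ⟨fun h ↦ by simpa using h.inv, IsElliptic.inv⟩

lemma moveDir_inv (w : Iso n) : moveDir w⁻¹ = moveDir w := by
  rw [moveDir, linearPart_inv, moveSpace_inv, moveDir]

lemma moveDim_inv (w : Iso n) : moveDim w⁻¹ = moveDim w := by
  rw [moveDim, moveDir_inv, moveDim]

lemma moveDir_mul_le (u v : Iso n) : moveDir (u * v) ≤ moveDir u ⊔ moveDir v := by
  rw [moveDir, linearPart_mul]
  exact moveSpace_mul_le _ _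

lemma moveDim_mul_le (u v : Iso n) : moveDim (u * v) ≤ moveDim u + moveDim v := by
  rw [moveDim, moveDir, linearPart_mul]
  exact finrank_moveSpace_mul_le _ _

lemma moveDim_one : moveDim (1 : Iso n) = 0 := by
  rw [moveDim, Submodule.finrank_eq_zero, moveDir, linearPart_one, moveSpace_eq_bot]

lemma isElliptic_one : IsElliptic (1 : Iso n) := ⟨0, rfl⟩

lemma IsElliptic.eq_one {w : Iso n} (h : IsElliptic w) (hw : moveDim w = 0) : w = 1 := by
  obtain ⟨p, hp⟩ := h
  rw [moveDim, Submodule.finrank_eq_zero, moveDir, moveSpace_eq_bot] at hw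
  exact iso_ext_of_linearPart (hw.trans linearPart_one.symm) hp

lemma sub_mem_moveDir_orthogonal_iff {w : Iso n} {p : Euc n} (hp : w p = p) (q : Euc n) :
    q - p ∈ (moveDir w)ᗮ ↔ w q = q := by
  rw [moveDir, mem_moveSpace_orthogonal, linearPart_sub, hp, sub_left_inj]

/-- The reflection with root `α` in the hyperplane through `p`. -/
def hyperplaneReflection (α p : Euc n) : Iso n :=
  ((IsometryEquiv.subRight p).trans (rootReflection α).toIsometryEquiv).trans
    (IsometryEquiv.addRight p)

lemma hyperplaneReflection_apply (α p x : Euc n) :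
    hyperplaneReflection α p x = rootReflection α (x - p) + p := rfl

lemma hyperplaneReflection_self (α p : Euc n) : hyperplaneReflection α p p = p := by
  simp [hyperplaneReflection_apply]

lemma linearPart_hyperplaneReflection (α p : Euc n) :
    linearPart (hyperplaneReflection α p) = rootReflection α :=
  LinearIsometryEquiv.ext fun x ↦ by
    have := linearPart_sub (hyperplaneReflection α p) (x + p) p
    simpa [hyperplaneReflection_apply] using this

lemma hyperplaneReflection_inv (α p : Euc n) :
    (hyperplaneReflection α p)⁻¹ = hyperplaneReflection α p := by
  rw [inv_eq_iff_mul_eq_one]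
  exact IsometryEquiv.ext fun x ↦ by
    simp [IsometryEquiv.mul_apply, hyperplaneReflection_apply, Submodule.reflection_reflection]

lemma hyperplaneReflection_mul_self (α p : Euc n) :
    hyperplaneReflection α p * hyperplaneReflection α p = 1 := by
  nth_rw 1 [← hyperplaneReflection_inv]
  exact inv_mul_cancel _

lemma isElliptic_hyperplaneReflection (α p : Euc n) : IsElliptic (hyperplaneReflection α p) :=
  ⟨p, hyperplaneReflection_self α p⟩

lemma moveDir_hyperplaneReflection (α p : Euc n) : moveDir (hyperplaneReflection α p) = ℝ ∙ α := by
  rw [moveDir, linearPart_hyperplaneReflection, moveSpace_rootReflection]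

lemma moveDim_hyperplaneReflection {α : Euc n} (hα : α ≠ 0) (p : Euc n) :
    moveDim (hyperplaneReflection α p) = 1 := by
  rw [moveDim, moveDir_hyperplaneReflection, finrank_span_singleton hα]

/-- Fixed points of a reflection form a hyperplane. -/
lemma hyperplaneReflection_apply_eq_self_iff (α p x : Euc n) :
    hyperplaneReflection α p x = x ↔ ⟪α, x - p⟫ = 0 := by
  rw [← sub_mem_moveDir_orthogonal_iff (hyperplaneReflection_self α p),
    moveDir_hyperplaneReflection, Submodule.mem_orthogonal_singleton_iff_inner_right]

lemma exists_eq_hyperplaneReflection {w : Iso n} (hw : IsElliptic w) (h : moveDim w = 1) :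
    ∃ α p, α ≠ 0 ∧ w = hyperplaneReflection α p := by
  obtain ⟨p, hp⟩ := hw
  have hne : moveDir w ≠ ⊥ := by
    intro h0
    rw [moveDim, h0] at h
    simp at h
  obtain ⟨α, hα, hα0⟩ := Submodule.exists_mem_ne_zero_of_ne_bot hne
  refine ⟨α, p, hα0, iso_ext_of_linearPart (p := p) ?_ ?_⟩
  · rw [linearPart_hyperplaneReflection]
    exact eq_rootReflection h.le hα0 hα
  · rw [hp, hyperplaneReflection_self]

lemma isReflection_iff {r : Iso n} : IsReflection n r ↔ IsElliptic r ∧ moveDim r = 1 := by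
  constructor
  · rintro ⟨hr, H, ⟨p, hp⟩, hH, hfix⟩
    have hell : IsElliptic r := ⟨p, hfix p hp⟩
    refine ⟨hell, le_antisymm ?_ ?_⟩
    · have hle : H.direction ≤ (moveDir r)ᗮ := by
        intro v hv
        have h1 := (sub_mem_moveDir_orthogonal_iff (hfix p hp) (v +ᵥ p)).2
          (hfix _ (AffineSubspace.vadd_mem_of_mem_direction hv hp))
        simpa using h1
      have h1 := Submodule.finrank_mono hle
      have h2 := (moveDir r).finrank_add_finrank_orthogonal
      rw [finrank_euclideanSpace_fin] at h2
      rw [moveDim]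
      omega
    · by_contra h
      exact hr (hell.eq_one (by omega))
  · rintro ⟨hell, hdim⟩
    obtain ⟨p, hp⟩ := hell
    refine ⟨?_, AffineSubspace.mk' p (moveDir r)ᗮ, AffineSubspace.mk'_nonempty _ _, ?_, ?_⟩
    · rintro rfl
      rw [moveDim_one] at hdim
      omega
    · have h2 := (moveDir r).finrank_add_finrank_orthogonal
      rw [finrank_euclideanSpace_fin] at h2
      rw [moveDim] at hdim
      rw [AffineSubspace.direction_mk']
      omega
    · intro x hx
      rw [AffineSubspace.mem_mk'] at hx
      exact (sub_mem_moveDir_orthogonal_iff hp x).1 hx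

lemma isReflection_hyperplaneReflection {α : Euc n} (hα : α ≠ 0) (p : Euc n) :
    IsReflection n (hyperplaneReflection α p) :=
  isReflection_iff.2 ⟨isElliptic_hyperplaneReflection α p, moveDim_hyperplaneReflection hα p⟩

lemma moveDim_hyperplaneReflection_mul_le (α p : Euc n) (w : Iso n) :
    moveDim (hyperplaneReflection α p * w) ≤ moveDim w + 1 := by
  rw [moveDim, moveDir, linearPart_mul, linearPart_hyperplaneReflection]
  exact finrank_moveSpace_rootReflection_mul_le _ _

lemma moveDim_hyperplaneReflection_mul {α : Euc n} (hα : α ≠ 0) (p : Euc n) {w : Iso n}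
    (h : α ∈ moveDir w) : moveDim (hyperplaneReflection α p * w) + 1 = moveDim w := by
  rw [moveDim, moveDir, linearPart_mul, linearPart_hyperplaneReflection]
  exact finrank_moveSpace_rootReflection_mul hα h


open Classical in
/-- The value that the reflection length turns out to have (`reflLen_eq_scherkLength`). -/
def scherkLength (w : Iso n) : ℕ := if IsElliptic w then moveDim w else moveDim w + 2

lemma IsElliptic.scherkLength {w : Iso n} (h : IsElliptic w) : scherkLength w = moveDim w :=
  if_pos h

lemma scherkLength_of_not_isElliptic {w : Iso n} (h : ¬ IsElliptic w) :
    scherkLength w = moveDim w + 2 := if_neg h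

lemma moveDim_le_scherkLength (w : Iso n) : moveDim w ≤ scherkLength w := by
  unfold scherkLength
  split_ifs <;> omega

lemma scherkLength_le (w : Iso n) : scherkLength w ≤ moveDim w + 2 := by
  unfold scherkLength
  split_ifs <;> omega

lemma scherkLength_hyperplaneReflection_mul_le {α : Euc n} (hα : α ≠ 0) (p : Euc n) (w : Iso n) :
    scherkLength (hyperplaneReflection α p * w) ≤ scherkLength w + 1 := by
  have h1 := moveDim_hyperplaneReflection_mul_le α p w
  have h2 := scherkLength_le (hyperplaneReflection α p * w)
  by_cases hw : IsElliptic w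
  · by_cases hrw : IsElliptic (hyperplaneReflection α p * w)
    · rw [hw.scherkLength, hrw.scherkLength]
      exact h1
    · have hα' : α ∈ moveDir w := by
        by_contra hmem
        obtain ⟨q, hq⟩ := hw
        rw [← Submodule.orthogonal_orthogonal (moveDir w), Submodule.mem_orthogonal] at hmem
        push Not at hmem
        obtain ⟨v, hv, hne⟩ := hmem
        -- slide `q` along `v` inside the fixed space of `w` until it reaches the mirror
        let t : ℝ := ⟪α, p - q⟫ / ⟪α, v⟫
        have hne' : ⟪α, v⟫ ≠ 0 := by rwa [real_inner_comm]
        have hfix : w (t • v + q) = t • v + q := by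
          rw [← sub_mem_moveDir_orthogonal_iff hq, add_sub_cancel_right]
          exact Submodule.smul_mem _ _ hv
        refine hrw ⟨t • v + q, ?_⟩
        rw [IsometryEquiv.mul_apply, hfix, hyperplaneReflection_apply_eq_self_iff]
        have : t • v + q - p = t • v - (p - q) := by abel
        rw [this, inner_sub_right, inner_smul_right]
        simp [t, div_mul_cancel₀ _ hne']
      have := moveDim_hyperplaneReflection_mul hα p hα'
      rw [hw.scherkLength]
      omega
  · rw [scherkLength_of_not_isElliptic hw]
    omega

lemma scherkLength_le_length (l : List (Iso n)) (hl : ∀ r ∈ l, IsReflection n r) :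
    scherkLength l.prod ≤ l.length := by
  induction l with
  | nil => simp [isElliptic_one.scherkLength, moveDim_one]
  | cons r l ih =>
    obtain ⟨hr, hl'⟩ := List.forall_mem_cons.1 hl
    obtain ⟨α, p, hα, rfl⟩ := (isReflection_iff.1 hr).elim exists_eq_hyperplaneReflection
    have := scherkLength_hyperplaneReflection_mul_le hα p l.prod
    have := ih hl'
    simp only [List.prod_cons, List.length_cons]
    omega

lemma exists_hyperplaneReflection_mul_elliptic {w : Iso n} {p : Euc n} (h : w p ≠ p) :
    ∃ α q, α ≠ 0 ∧ IsElliptic (hyperplaneReflection α q * w) := by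
  refine ⟨w p - p, midpoint ℝ (w p) p, sub_ne_zero.2 h, p, ?_⟩
  rw [IsometryEquiv.mul_apply, hyperplaneReflection_apply]
  have h1 : w p - midpoint ℝ (w p) p = (1 / 2 : ℝ) • (w p - p) := by
    rw [midpoint_eq_smul_add]
    simp only [invOf_eq_inv]
    module
  rw [h1, map_smul, Submodule.reflection_orthogonalComplement_singleton_eq_neg,
    midpoint_eq_smul_add]
  simp only [invOf_eq_inv]
  module

lemma IsElliptic.exists_list {w : Iso n} (hw : IsElliptic w) :
    ∃ l : List (Iso n), l.length = moveDim w ∧ (∀ r ∈ l, IsReflection n r) ∧ l.prod = w := by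
  induction hd : moveDim w generalizing w with
  | zero => exact ⟨[], rfl, by simp, (hw.eq_one hd).symm⟩
  | succ d ih =>
    have hne : moveDir w ≠ ⊥ := by
      intro h0
      rw [moveDim, h0] at hd
      simp at hd
    obtain ⟨α, hα, hα0⟩ := Submodule.exists_mem_ne_zero_of_ne_bot hne
    obtain ⟨p, hp⟩ := hw
    have h1 := moveDim_hyperplaneReflection_mul hα0 p hα
    obtain ⟨l, hlen, hl, hprod⟩ := ih (w := hyperplaneReflection α p * w)
      ⟨p, by rw [IsometryEquiv.mul_apply, hp, hyperplaneReflection_self]⟩ (by omega)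
    refine ⟨hyperplaneReflection α p :: l, by simp [hlen], ?_, ?_⟩
    · exact List.forall_mem_cons.2 ⟨isReflection_hyperplaneReflection hα0 p, hl⟩
    · rw [List.prod_cons, hprod, ← mul_assoc, hyperplaneReflection_mul_self, one_mul]

lemma exists_list_length_le (w : Iso n) :
    ∃ l : List (Iso n), l.length ≤ scherkLength w ∧ (∀ r ∈ l, IsReflection n r) ∧ l.prod = w := by
  by_cases hw : IsElliptic w
  · obtain ⟨l, hlen, h⟩ := hw.exists_list
    exact ⟨l, by rw [hw.scherkLength, hlen], h⟩
  · obtain ⟨α, q, hα, hell⟩ :=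
      exists_hyperplaneReflection_mul_elliptic (w := w) (p := 0) fun h ↦ hw ⟨0, h⟩
    obtain ⟨l, hlen, hl, hprod⟩ := hell.exists_list
    have h1 := moveDim_hyperplaneReflection_mul_le α q w
    refine ⟨hyperplaneReflection α q :: l, ?_, ?_, ?_⟩
    · rw [scherkLength_of_not_isElliptic hw, List.length_cons]
      omega
    · exact List.forall_mem_cons.2 ⟨isReflection_hyperplaneReflection hα q, hl⟩
    · rw [List.prod_cons, hprod, ← mul_assoc, hyperplaneReflection_mul_self, one_mul]

lemma reflLen_prod_le (l : List (Iso n)) (hl : ∀ r ∈ l, IsReflection n r) :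
    reflLen n l.prod ≤ l.length := Nat.sInf_le ⟨l, rfl, hl, rfl⟩

/-- Scherk's theorem: the reflection length of an isometry is the dimension of its move-set,
plus two if it is hyperbolic. -/
theorem reflLen_eq_scherkLength (w : Iso n) : reflLen n w = scherkLength w := by
  obtain ⟨l, hlen, hl, rfl⟩ := exists_list_length_le w
  refine le_antisymm ((reflLen_prod_le l hl).trans hlen) ?_
  refine le_csInf ⟨_, l, rfl, hl, rfl⟩ ?_
  rintro k ⟨l', rfl, hl', h⟩
  exact h ▸ scherkLength_le_length l' hl'

lemma IsElliptic.reflLen {w : Iso n} (h : IsElliptic w) : reflLen n w = moveDim w := by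
  rw [reflLen_eq_scherkLength, h.scherkLength]

lemma reflLen_of_not_isElliptic {w : Iso n} (h : ¬ IsElliptic w) :
    reflLen n w = moveDim w + 2 := by
  rw [reflLen_eq_scherkLength, scherkLength_of_not_isElliptic h]

lemma moveDim_le_reflLen (w : Iso n) : moveDim w ≤ reflLen n w :=
  reflLen_eq_scherkLength w ▸ moveDim_le_scherkLength w

lemma isElliptic_of_reflLen_le {w : Iso n} (h : reflLen n w ≤ moveDim w) : IsElliptic w := by
  by_contra hw
  rw [reflLen_of_not_isElliptic hw] at h
  omega

lemma reflLen_inv (w : Iso n) : reflLen n w⁻¹ = reflLen n w := by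
  by_cases h : IsElliptic w
  · rw [h.reflLen, h.inv.reflLen, moveDim_inv]
  · rw [reflLen_of_not_isElliptic h, reflLen_of_not_isElliptic (isElliptic_inv.not.2 h),
      moveDim_inv]

lemma reflLen_one : reflLen n (1 : Iso n) = 0 := by
  rw [isElliptic_one.reflLen, moveDim_one]

lemma reflLen_eq_zero {w : Iso n} : reflLen n w = 0 ↔ w = 1 := by
  refine ⟨fun h ↦ ?_, fun h ↦ h ▸ reflLen_one⟩
  exact (isElliptic_of_reflLen_le (by omega)).eq_one (by have := moveDim_le_reflLen w; omega)

lemma reflLen_mul_le (u v : Iso n) : reflLen n (u * v) ≤ reflLen n u + reflLen n v := by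
  obtain ⟨l, hlen, hl, rfl⟩ := exists_list_length_le u
  obtain ⟨l', hlen', hl', rfl⟩ := exists_list_length_le v
  rw [reflLen_eq_scherkLength l.prod, reflLen_eq_scherkLength l'.prod]
  have h := reflLen_prod_le (l ++ l') fun r hr ↦ (List.mem_append.1 hr).elim (hl r) (hl' r)
  rw [List.prod_append, List.length_append] at h
  omega

lemma reflLen_eq_one {w : Iso n} : reflLen n w = 1 ↔ IsElliptic w ∧ moveDim w = 1 := by
  constructor
  · intro h
    have hw : IsElliptic w := by
      by_contra hw
      rw [reflLen_of_not_isElliptic hw] at h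
      omega
    exact ⟨hw, hw.reflLen ▸ h⟩
  · rintro ⟨hw, h⟩
    rw [hw.reflLen, h]

lemma reflLen_hyperplaneReflection {α : Euc n} (hα : α ≠ 0) (p : Euc n) :
    reflLen n (hyperplaneReflection α p) = 1 :=
  reflLen_eq_one.2 ⟨isElliptic_hyperplaneReflection α p, moveDim_hyperplaneReflection hα p⟩

/-- The prefix order of the reflection length (the absolute order). -/
def PrefixLE (u v : Iso n) : Prop := reflLen n u + reflLen n (u⁻¹ * v) = reflLen n v

lemma reflLen_le_add_inv_mul (u v : Iso n) :
    reflLen n v ≤ reflLen n u + reflLen n (u⁻¹ * v) := by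
  simpa using reflLen_mul_le u (u⁻¹ * v)

lemma prefixLE_iff_le {u v : Iso n} :
    PrefixLE u v ↔ reflLen n u + reflLen n (u⁻¹ * v) ≤ reflLen n v :=
  ⟨fun h ↦ h.le, fun h ↦ le_antisymm h (reflLen_le_add_inv_mul u v)⟩

lemma PrefixLE.refl (u : Iso n) : PrefixLE u u := by
  rw [PrefixLE, inv_mul_cancel, reflLen_one, add_zero]

lemma PrefixLE.one (u : Iso n) : PrefixLE 1 u := by
  rw [PrefixLE, inv_one, one_mul, reflLen_one, zero_add]

lemma PrefixLE.trans {u v w : Iso n} (h : PrefixLE u v) (h' : PrefixLE v w) : PrefixLE u w := by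
  rw [prefixLE_iff_le]
  have h1 := reflLen_mul_le (u⁻¹ * v) (v⁻¹ * w)
  rw [show u⁻¹ * v * (v⁻¹ * w) = u⁻¹ * w by group] at h1
  rw [PrefixLE] at h h'
  omega

lemma PrefixLE.reflLen_le {u v : Iso n} (h : PrefixLE u v) : reflLen n u ≤ reflLen n v := by
  rw [PrefixLE] at h
  omega

lemma PrefixLE.eq_of_reflLen_le {u v : Iso n} (h : PrefixLE u v)
    (hl : reflLen n v ≤ reflLen n u) : u = v := by
  rw [PrefixLE] at h
  have : reflLen n (u⁻¹ * v) = 0 := by omega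
  rwa [reflLen_eq_zero, inv_mul_eq_one] at this

lemma intervalLE_iff {w u v : Iso n} : intervalLE n w u v ↔ PrefixLE u v ∧ PrefixLE v w := by
  have h1 := reflLen_le_add_inv_mul u v
  have h2 := reflLen_le_add_inv_mul v w
  simp only [intervalLE, PrefixLE]
  omega

/-- Two elements below `w` have a join and a meet in the interval from `1` to `w`. -/
def HasJoinMeet (w u v : Iso n) : Prop :=
  (∃ j, PrefixLE j w ∧ PrefixLE u j ∧ PrefixLE v j ∧
    ∀ j', PrefixLE j' w → PrefixLE u j' → PrefixLE v j' → PrefixLE j j') ∧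
  (∃ m, PrefixLE m u ∧ PrefixLE m v ∧ ∀ m', PrefixLE m' u → PrefixLE m' v → PrefixLE m' m)

lemma hasJoinMeet_iff {w u v : Iso n} (hu : PrefixLE u w) (hv : PrefixLE v w) :
    ((∃ j, inInterval n w j ∧ intervalLE n w u j ∧ intervalLE n w v j ∧
        ∀ j', inInterval n w j' → intervalLE n w u j' → intervalLE n w v j' →
          intervalLE n w j j') ∧
      (∃ m, inInterval n w m ∧ intervalLE n w m u ∧ intervalLE n w m v ∧
        ∀ m', inInterval n w m' → intervalLE n w m' u → intervalLE n w m' v →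
          intervalLE n w m' m)) ↔ HasJoinMeet w u v := by
  have e : ∀ x, inInterval n w x ↔ PrefixLE x w := fun x ↦ Iff.rfl
  simp only [e, intervalLE_iff]
  constructor
  · rintro ⟨⟨j, hj, ⟨huj, -⟩, ⟨hvj, -⟩, hmin⟩, m, hm, ⟨hmu, -⟩, ⟨hmv, -⟩, hmax⟩
    exact ⟨⟨j, hj, huj, hvj, fun j' h h1 h2 ↦ (hmin j' h ⟨h1, h⟩ ⟨h2, h⟩).1⟩,
      m, hmu, hmv, fun m' h1 h2 ↦ (hmax m' (h1.trans hu) ⟨h1, hu⟩ ⟨h2, hv⟩).1⟩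
  · rintro ⟨⟨j, hj, huj, hvj, hmin⟩, m, hmu, hmv, hmax⟩
    exact ⟨⟨j, hj, ⟨huj, hj⟩, ⟨hvj, hj⟩, fun j' h h1 h2 ↦ ⟨hmin j' h h1.1 h2.1, h⟩⟩,
      m, hmu.trans hu, ⟨hmu, hu⟩, ⟨hmv, hv⟩,
      fun m' _ h1 h2 ↦ ⟨hmax m' h1.1 h2.1, hmu.trans hu⟩⟩

lemma moveDir_mul_of_moveDim_le {u x : Iso n} (h : moveDim u + moveDim x ≤ moveDim (u * x)) :
    moveDir (u * x) = moveDir u ⊔ moveDir x ∧ Disjoint (moveDir u) (moveDir x) := by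
  have h1 := Submodule.finrank_sup_add_finrank_inf_eq (moveDir u) (moveDir x)
  have h2 := Submodule.finrank_mono (moveDir_mul_le u x)
  simp only [moveDim] at h
  refine ⟨Submodule.eq_of_le_of_finrank_le (moveDir_mul_le u x) (by omega), ?_⟩
  rw [disjoint_iff, ← Submodule.finrank_eq_zero (R := ℝ)]
  omega

section Elliptic

variable {u v w : Iso n}

lemma PrefixLE.elliptic_factors (h : PrefixLE u w) (hw : IsElliptic w) :
    IsElliptic u ∧ IsElliptic (u⁻¹ * w) ∧ moveDir w = moveDir u ⊔ moveDir (u⁻¹ * w) ∧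
      Disjoint (moveDir u) (moveDir (u⁻¹ * w)) := by
  have h0 : u * (u⁻¹ * w) = w := mul_inv_cancel_left u w
  have h1 := moveDim_mul_le u (u⁻¹ * w)
  have h2 := moveDim_le_reflLen u
  have h3 := moveDim_le_reflLen (u⁻¹ * w)
  have h4 := moveDir_mul_of_moveDim_le (u := u) (x := u⁻¹ * w)
  rw [PrefixLE, hw.reflLen] at h
  rw [h0] at h1 h4
  exact ⟨isElliptic_of_reflLen_le (by omega), isElliptic_of_reflLen_le (by omega), h4 (by omega)⟩

lemma PrefixLE.isElliptic (h : PrefixLE u w) (hw : IsElliptic w) : IsElliptic u :=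
  (h.elliptic_factors hw).1

lemma PrefixLE.moveDir_le (h : PrefixLE u w) (hw : IsElliptic w) : moveDir u ≤ moveDir w := by
  rw [(h.elliptic_factors hw).2.2.1]
  exact le_sup_left

lemma PrefixLE.apply_eq_self (h : PrefixLE u w) {p : Euc n} (hp : w p = p) : u p = p := by
  obtain ⟨hu, hx, -, hd⟩ := h.elliptic_factors ⟨p, hp⟩
  have hux : u ((u⁻¹ * w) p) = p := by
    rw [← IsometryEquiv.mul_apply, mul_inv_cancel_left, hp]
  have h1 := neg_mem (hu.apply_sub_mem ((u⁻¹ * w) p))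
  rw [hux, neg_sub] at h1
  have h2 := Submodule.disjoint_def.1 hd _ h1 (hx.apply_sub_mem p)
  rwa [sub_eq_zero.1 h2] at hux

/-- Below an elliptic isometry, elements are determined by their move-sets. -/
lemma PrefixLE.eq_of_moveDir_eq (hw : IsElliptic w) (hu : PrefixLE u w) (hv : PrefixLE v w)
    (h : moveDir u = moveDir v) : u = v := by
  obtain ⟨p, hp⟩ := id hw
  obtain ⟨-, -, -, hd⟩ := hu.elliptic_factors hw
  obtain ⟨-, -, -, hd'⟩ := hv.elliptic_factors hw
  refine iso_ext_of_linearPart ?_ ((hu.apply_eq_self hp).trans (hv.apply_eq_self hp).symm)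
  refine eq_of_mul_eq_mul_of_disjoint ?_ hd hd' h
  rw [← linearPart_mul, ← linearPart_mul, mul_inv_cancel_left, mul_inv_cancel_left]

lemma exists_mul_hyperplaneReflection {φ : Euc n} (hφ : φ ≠ 0) (h : φ ∈ moveDir w) :
    ∃ β ∈ moveDir w, β ≠ 0 ∧ ∀ p,
      moveDir (w * hyperplaneReflection β p) = moveDir w ⊓ (ℝ ∙ φ)ᗮ ∧
      moveDim (w * hyperplaneReflection β p) + 1 = moveDim w := by
  obtain ⟨β, hβ, hβ0, h1, h2⟩ := exists_moveSpace_mul_rootReflection hφ h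
  refine ⟨β, hβ, hβ0, fun p ↦ ?_⟩
  rw [moveDim, moveDir, linearPart_mul, linearPart_hyperplaneReflection]
  exact ⟨h1, h2⟩

lemma reflLen_mul_hyperplaneReflection_inv_mul {β : Euc n} (hβ : β ≠ 0) (p : Euc n) :
    reflLen n ((w * hyperplaneReflection β p)⁻¹ * w) = 1 := by
  rw [mul_inv_rev, inv_mul_cancel_right, hyperplaneReflection_inv,
    reflLen_hyperplaneReflection hβ]

/-- Below an elliptic isometry, every subspace of the move-set is a move-set. -/
lemma IsElliptic.exists_prefixLE (hw : IsElliptic w) {U : Submodule ℝ (Euc n)}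
    (hU : U ≤ moveDir w) : ∃ u, PrefixLE u w ∧ moveDir u = U := by
  induction hd : moveDim w generalizing w with
  | zero =>
    have h0 : moveDir w = ⊥ := Submodule.finrank_eq_zero.1 hd
    exact ⟨w, PrefixLE.refl w, by rw [h0] at hU ⊢; exact (le_bot_iff.1 hU).symm⟩
  | succ d ih =>
    rcases hU.eq_or_lt with rfl | hlt
    · exact ⟨w, PrefixLE.refl w, rfl⟩
    have hne : Uᗮ ⊓ moveDir w ≠ ⊥ := fun h0 ↦ hlt.ne <|
      Submodule.eq_of_le_of_finrank_le hU <| by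
        have := Submodule.finrank_add_inf_finrank_orthogonal hU
        rw [h0, finrank_bot] at this
        omega
    obtain ⟨φ, ⟨hφU, hφ⟩, hφ0⟩ := Submodule.exists_mem_ne_zero_of_ne_bot hne
    obtain ⟨β, hβ, hβ0, hβw⟩ := exists_mul_hyperplaneReflection hφ0 hφ
    obtain ⟨p, hp⟩ := id hw
    obtain ⟨h1, h2⟩ := hβw p
    have hell : IsElliptic (w * hyperplaneReflection β p) :=
      ⟨p, by rw [IsometryEquiv.mul_apply, hyperplaneReflection_self, hp]⟩
    obtain ⟨u, hu, rfl⟩ := ih hell (by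
      rw [h1]
      refine le_inf hU fun x hx ↦ ?_
      rw [Submodule.mem_orthogonal_singleton_iff_inner_left]
      exact hφU x hx) (by omega)
    refine ⟨u, hu.trans ?_, rfl⟩
    rw [PrefixLE, reflLen_mul_hyperplaneReflection_inv_mul hβ0, hell.reflLen, hw.reflLen, h2]

lemma prefixLE_of_moveDir_le (hw : IsElliptic w) (hu : PrefixLE u w) (hv : PrefixLE v w)
    (h : moveDir u ≤ moveDir v) : PrefixLE u v := by
  obtain ⟨u', hu', h'⟩ := (hv.isElliptic hw).exists_prefixLE h
  rwa [hu.eq_of_moveDir_eq hw (hu'.trans hv) h'.symm]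

lemma IsElliptic.hasJoinMeet (hw : IsElliptic w) (hu : PrefixLE u w) (hv : PrefixLE v w) :
    HasJoinMeet w u v := by
  have hle := hu.moveDir_le hw
  obtain ⟨j, hj, hjdir⟩ := hw.exists_prefixLE (sup_le hle (hv.moveDir_le hw))
  obtain ⟨m, hm, hmdir⟩ := hw.exists_prefixLE (inf_le_left.trans hle : moveDir u ⊓ moveDir v ≤ _)
  refine ⟨⟨j, hj, ?_, ?_, fun j' hj' hu' hv' ↦ ?_⟩, m, ?_, ?_, fun m' hu' hv' ↦ ?_⟩
  · exact prefixLE_of_moveDir_le hw hu hj (hjdir ▸ le_sup_left)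
  · exact prefixLE_of_moveDir_le hw hv hj (hjdir ▸ le_sup_right)
  · exact prefixLE_of_moveDir_le hw hj hj' <| hjdir ▸
      sup_le (hu'.moveDir_le (hj'.isElliptic hw)) (hv'.moveDir_le (hj'.isElliptic hw))
  · exact prefixLE_of_moveDir_le hw hm hu (hmdir ▸ inf_le_left)
  · exact prefixLE_of_moveDir_le hw hm hv (hmdir ▸ inf_le_right)
  · exact prefixLE_of_moveDir_le hw (hu'.trans hu) hm <| hmdir ▸
      le_inf (hu'.moveDir_le (hu.isElliptic hw)) (hv'.moveDir_le (hv.isElliptic hw))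

end Elliptic

section Hyperbolic

variable {u v w : Iso n}

lemma PrefixLE.movSet_subset (h : PrefixLE u w) (hu : ¬ IsElliptic u) (hw : ¬ IsElliptic w) :
    MovSet n u ⊆ MovSet n w := by
  have h0 : u * (u⁻¹ * w) = w := mul_inv_cancel_left u w
  have h1 := moveDim_mul_le u (u⁻¹ * w)
  have h3 := moveDim_le_reflLen (u⁻¹ * w)
  have h4 := moveDir_mul_of_moveDim_le (u := u) (x := u⁻¹ * w)
  rw [PrefixLE, reflLen_of_not_isElliptic hu, reflLen_of_not_isElliptic hw] at h
  rw [h0] at h1 h4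
  obtain ⟨q, hq⟩ := isElliptic_of_reflLen_le (w := u⁻¹ * w) (by omega)
  have hwq : w q = u q := by
    nth_rw 1 [← h0, IsometryEquiv.mul_apply, hq]
  intro x hx
  rw [mem_movSet q, hwq, (h4 (by omega)).1]
  exact Submodule.mem_sup_left ((mem_movSet q).1 hx)

/-- If the move-set of a hyperbolic isometry has dimension at least two, its interval is not a
lattice: two parallel reflections have no join. -/
lemma exists_not_hasJoinMeet (hw : ¬ IsElliptic w) (hdim : 2 ≤ moveDim w) :
    ∃ r r', PrefixLE r w ∧ PrefixLE r' w ∧ ¬ HasJoinMeet w r r' := by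
  have hne : moveDir w ≠ ⊥ := by
    intro h0
    rw [moveDim, h0, finrank_bot] at hdim
    omega
  obtain ⟨φ, hφ, hφ0⟩ := Submodule.exists_mem_ne_zero_of_ne_bot hne
  obtain ⟨β, hβ, hβ0, hβw⟩ := exists_mul_hyperplaneReflection hφ0 hφ
  have hwq : ∀ q, (w * hyperplaneReflection β q) q = w q := fun q ↦ by
    rw [IsometryEquiv.mul_apply, hyperplaneReflection_self]
  have hhyp : ∀ q, ¬ IsElliptic (w * hyperplaneReflection β q) := fun q h ↦ hw <| by
    rw [isElliptic_iff_apply_sub_mem q] at h ⊢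
    rw [hwq, (hβw q).1] at h
    exact h.1
  have hlen : ∀ q, reflLen n (w * hyperplaneReflection β q) = moveDim w + 1 := fun q ↦ by
    rw [reflLen_of_not_isElliptic (hhyp q), ← (hβw q).2]
  have hle : ∀ q, PrefixLE (w * hyperplaneReflection β q) w := fun q ↦ by
    rw [PrefixLE, reflLen_mul_hyperplaneReflection_inv_mul hβ0, hlen,
      reflLen_of_not_isElliptic hw]
  obtain ⟨x, hx⟩ := mem_moveSpace.1 hφ
  have hne' : moveDir w ⊓ (ℝ ∙ φ)ᗮ ≠ ⊥ := by
    intro h0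
    have := (hβw 0).2
    rw [moveDim, (hβw 0).1, h0, finrank_bot] at this
    omega
  obtain ⟨α, hα, hα0⟩ := Submodule.exists_mem_ne_zero_of_ne_bot hne'
  have hrle : ∀ p q, PrefixLE (hyperplaneReflection α p) (w * hyperplaneReflection β q) := by
    intro p q
    have h1 := moveDim_hyperplaneReflection_mul (w := w * hyperplaneReflection β q) hα0 p
      (by rwa [(hβw q).1])
    have h2 := reflLen_eq_scherkLength
      (hyperplaneReflection α p * (w * hyperplaneReflection β q))
    have h3 := scherkLength_le (hyperplaneReflection α p * (w * hyperplaneReflection β q))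
    rw [prefixLE_iff_le, reflLen_of_not_isElliptic (hhyp q), reflLen_hyperplaneReflection hα0,
      hyperplaneReflection_inv]
    omega
  refine ⟨hyperplaneReflection α 0, hyperplaneReflection α α, (hrle _ 0).trans (hle _),
    (hrle _ 0).trans (hle _), ?_⟩
  rintro ⟨⟨j, -, hrj, hrj', hmin⟩, -⟩
  have hj : ¬ IsElliptic j := by
    rintro ⟨p, hp⟩
    have h1 := hrj.apply_eq_self hp
    have h2 := hrj'.apply_eq_self hp
    rw [hyperplaneReflection_apply_eq_self_iff] at h1 h2
    rw [inner_sub_right] at h1 h2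
    exact hα0 (inner_self_eq_zero (𝕜 := ℝ).1 (by simp at h1; linarith))
  have hmem : ∀ q, ⟪φ, j 0 - 0⟫ = ⟪φ, w q - q⟫ := fun q ↦ by
    have h1 := (hmin _ (hle q) (hrle _ q) (hrle _ q)).movSet_subset hj (hhyp q)
      (apply_sub_mem_movSet j 0)
    rw [mem_movSet q, (hβw q).1, hwq] at h1
    have h2 := Submodule.mem_orthogonal_singleton_iff_inner_right.1 h1.2
    rw [inner_sub_right] at h2
    linarith
  have h1 := (hmem x).symm.trans (hmem 0)
  rw [← sub_eq_zero, ← inner_sub_right,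
    show w x - x - (w 0 - 0) = (w x - w 0) - x by abel, ← linearPart_sub, sub_zero, hx] at h1
  exact hφ0 (inner_self_eq_zero.1 h1)

lemma PrefixLE.eq_or_reflLen_lt (h : PrefixLE u v) : u = v ∨ reflLen n u < reflLen n v :=
  (le_or_gt (reflLen n v) (reflLen n u)).imp_left h.eq_of_reflLen_le

/-- An interval of length at most three without bowties is a lattice. -/
lemma hasJoinMeet_of_reflLen_le_three (hlen : reflLen n w ≤ 3)
    (hbow : ∀ r r' v v', r ≠ r' → reflLen n r = 1 → reflLen n r' = 1 → reflLen n v = 2 →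
      reflLen n v' = 2 → PrefixLE r v → PrefixLE r' v → PrefixLE r v' → PrefixLE r' v' →
      PrefixLE v w → PrefixLE v' w → v = v')
    (hu : PrefixLE u w) (hv : PrefixLE v w) : HasJoinMeet w u v := by
  by_cases huv : PrefixLE u v
  · exact ⟨⟨v, hv, huv, PrefixLE.refl v, fun _ _ _ h ↦ h⟩,
      u, PrefixLE.refl u, huv, fun _ h _ ↦ h⟩
  by_cases hvu : PrefixLE v u
  · exact ⟨⟨u, hu, PrefixLE.refl u, hvu, fun _ _ h _ ↦ h⟩,
      v, hvu, PrefixLE.refl v, fun _ _ h ↦ h⟩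
  have hne : u ≠ v := fun h ↦ huv (h ▸ PrefixLE.refl u)
  have hpos : ∀ x, x ≠ 1 → 0 < reflLen n x := fun x hx ↦
    Nat.pos_of_ne_zero (reflLen_eq_zero.not.2 hx)
  have hu1 := hpos u fun h ↦ huv (h ▸ PrefixLE.one v)
  have hv1 := hpos v fun h ↦ hvu (h ▸ PrefixLE.one u)
  have hupper : ∀ j, PrefixLE j w → PrefixLE u j → PrefixLE v j → j ≠ w →
      reflLen n u = 1 ∧ reflLen n v = 1 ∧ reflLen n j = 2 := fun j hj huj hvj hjw ↦ by
    have h1 := hj.eq_or_reflLen_lt.resolve_left hjw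
    have h2 := huj.eq_or_reflLen_lt.resolve_left fun h ↦ hvu (h ▸ hvj)
    have h3 := hvj.eq_or_reflLen_lt.resolve_left fun h ↦ huv (h ▸ huj)
    omega
  have hlower : ∀ m, PrefixLE m u → PrefixLE m v → m ≠ 1 →
      reflLen n m = 1 ∧ reflLen n u = 2 ∧ reflLen n v = 2 := fun m hmu hmv hm ↦ by
    have h0 := hpos m hm
    have h1 := hu.eq_or_reflLen_lt.resolve_left fun h ↦ hvu (h ▸ hv)
    have h1' := hv.eq_or_reflLen_lt.resolve_left fun h ↦ huv (h ▸ hu)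
    have h2 := hmu.eq_or_reflLen_lt.resolve_left fun h ↦ huv (h ▸ hmv)
    have h3 := hmv.eq_or_reflLen_lt.resolve_left fun h ↦ hvu (h ▸ hmu)
    omega
  constructor
  · by_cases hj : ∃ j, PrefixLE j w ∧ PrefixLE u j ∧ PrefixLE v j ∧ j ≠ w
    · obtain ⟨j, hj, huj, hvj, hjw⟩ := hj
      refine ⟨j, hj, huj, hvj, fun j' hj' huj' hvj' ↦ ?_⟩
      by_cases hjw' : j' = w
      · exact hjw' ▸ hj
      obtain ⟨h1, h2, h3⟩ := hupper j hj huj hvj hjw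
      rw [hbow u v j j' hne h1 h2 h3 (hupper j' hj' huj' hvj' hjw').2.2 huj hvj huj' hvj' hj hj']
      exact PrefixLE.refl j'
    · push Not at hj
      exact ⟨w, PrefixLE.refl w, hu, hv, fun j' hj' huj' hvj' ↦
        hj j' hj' huj' hvj' ▸ PrefixLE.refl j'⟩
  · by_cases hm : ∃ m, PrefixLE m u ∧ PrefixLE m v ∧ m ≠ 1
    · obtain ⟨m, hmu, hmv, hm1⟩ := hm
      refine ⟨m, hmu, hmv, fun m' hmu' hmv' ↦ ?_⟩
      by_cases hm1' : m' = 1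
      · exact hm1' ▸ PrefixLE.one m
      obtain ⟨h1, h2, h3⟩ := hlower m hmu hmv hm1
      by_cases hmm : m = m'
      · exact hmm ▸ PrefixLE.refl m
      exact absurd (hbow m m' u v hmm h1 (hlower m' hmu' hmv' hm1').1 h2 h3
        hmu hmu' hmv hmv' hu hv) hne
    · push Not at hm
      exact ⟨1, PrefixLE.one u, PrefixLE.one v, fun m' hmu' hmv' ↦
        hm m' hmu' hmv' ▸ PrefixLE.refl m'⟩

lemma moveDir_eq_span (h : moveDim u = 1) {x : Euc n} (hx : x ∈ moveDir u) (hx0 : x ≠ 0) :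
    moveDir u = ℝ ∙ x := by
  refine (Submodule.eq_of_le_of_finrank_le ?_ ?_).symm
  · rwa [Submodule.span_singleton_le_iff_mem]
  · rw [finrank_span_singleton hx0]
    exact h.le

lemma linearPart_eq_one_of_reflLen_eq_two (hv : ¬ IsElliptic v) (hv2 : reflLen n v = 2) :
    linearPart v = 1 := by
  rw [reflLen_of_not_isElliptic hv] at hv2
  rw [← moveSpace_eq_bot, ← moveDir, ← Submodule.finrank_eq_zero (R := ℝ), ← moveDim]
  omega

/-- A translation above a reflection translates along the root. -/
lemma PrefixLE.apply_sub_mem_moveDir {r : Iso n} (h : PrefixLE r v) (hr : reflLen n r = 1)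
    (hv : ¬ IsElliptic v) (hv2 : reflLen n v = 2) (x : Euc n) : v x - x ∈ moveDir r := by
  have h0 : r * (r⁻¹ * v) = v := mul_inv_cancel_left r v
  have hlin := linearPart_eq_one_of_reflLen_eq_two hv hv2
  rw [PrefixLE, hr, hv2] at h
  obtain ⟨hell, -⟩ := reflLen_eq_one.1 (by omega : reflLen n (r⁻¹ * v) = 1)
  have hdir : moveDir (r⁻¹ * v) = moveDir r := by
    rw [moveDir, linearPart_mul, hlin, mul_one, ← moveDir, moveDir_inv]
  have h1 := (reflLen_eq_one.1 hr).1.apply_sub_mem ((r⁻¹ * v) x)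
  have h2 := hell.apply_sub_mem x
  rw [hdir] at h2
  rw [← IsometryEquiv.mul_apply, h0] at h1
  simpa using add_mem h1 h2

lemma moveDir_eq_sup_of_reflLen_eq_two {r r' : Iso n} (hne : r ≠ r') (hr : reflLen n r = 1)
    (hr' : reflLen n r' = 1) (hv : IsElliptic v) (hv2 : reflLen n v = 2) (hrv : PrefixLE r v)
    (hrv' : PrefixLE r' v) : moveDir v = moveDir r ⊔ moveDir r' := by
  have h1 := (reflLen_eq_one.1 hr).2
  have h2 := (reflLen_eq_one.1 hr').2
  have hlt : moveDir r < moveDir r ⊔ moveDir r' := by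
    refine lt_of_le_of_ne le_sup_left fun h ↦ hne (hrv.eq_of_moveDir_eq hv hrv' ?_)
    refine (Submodule.eq_of_le_of_finrank_le (sup_eq_left.1 h.symm) ?_).symm
    exact h1.le.trans h2.ge
  have h3 := Submodule.finrank_lt_finrank_of_lt hlt
  rw [hv.reflLen] at hv2
  rw [moveDim] at h1 hv2
  exact (Submodule.eq_of_le_of_finrank_le
    (sup_le (hrv.moveDir_le hv) (hrv'.moveDir_le hv)) (by omega)).symm

/-- A reflection is determined by its value at any point that it moves. -/
lemma eq_of_reflLen_eq_one {s s' : Iso n} (hs : reflLen n s = 1) (hs' : reflLen n s' = 1)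
    {p : Euc n} (h : s p = s' p) (hp : s p ≠ p) : s = s' := by
  obtain ⟨hell, hdim⟩ := reflLen_eq_one.1 hs
  obtain ⟨hell', hdim'⟩ := reflLen_eq_one.1 hs'
  have h1 := hell.apply_sub_mem p
  have h2 := hell'.apply_sub_mem p
  rw [← h] at h2
  refine iso_ext_of_linearPart ?_ h
  rw [eq_rootReflection hdim.le (sub_ne_zero.2 hp) h1,
    eq_rootReflection hdim'.le (sub_ne_zero.2 hp) h2]

/-- Below a glide reflection or a translation there are no bowties. -/
lemma eq_of_bowtie (hw : ¬ IsElliptic w) (hdim : moveDim w ≤ 1) {r r' v v' : Iso n}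
    (hne : r ≠ r') (hr : reflLen n r = 1) (hr' : reflLen n r' = 1) (hv : reflLen n v = 2)
    (hv' : reflLen n v' = 2) (hrv : PrefixLE r v) (hrv' : PrefixLE r' v) (hr_v' : PrefixLE r v')
    (hr'_v' : PrefixLE r' v') (hvw : PrefixLE v w) (hvw' : PrefixLE v' w) : v = v' := by
  have hlen := reflLen_of_not_isElliptic hw
  by_cases hdim0 : moveDim w = 0
  · rw [hvw.eq_of_reflLen_le (by omega), hvw'.eq_of_reflLen_le (by omega)]
  have hmixed : ∀ x y : Iso n, reflLen n y = 2 → PrefixLE r x →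
      PrefixLE r' x → PrefixLE r y → PrefixLE r' y → IsElliptic x → IsElliptic y := by
    intro x y hy hrx hrx' hry hry' hxe
    by_contra hye
    have h0 : y 0 - 0 ≠ 0 := fun h ↦ hye ⟨0, sub_eq_zero.1 h⟩
    refine hne (hrx.eq_of_moveDir_eq hxe hrx' ?_)
    rw [moveDir_eq_span (reflLen_eq_one.1 hr).2 (hry.apply_sub_mem_moveDir hr hye hy 0) h0,
      moveDir_eq_span (reflLen_eq_one.1 hr').2 (hry'.apply_sub_mem_moveDir hr' hye hy 0) h0]
  by_cases hve : IsElliptic v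
  · have hve' := hmixed v v' hv' hrv hrv' hr_v' hr'_v' hve
    obtain ⟨p, hp⟩ := id hve
    obtain ⟨q, hq⟩ := id hve'
    have hp' : v' p = p := by
      rw [← sub_mem_moveDir_orthogonal_iff hq,
        moveDir_eq_sup_of_reflLen_eq_two hne hr hr' hve' hv' hr_v' hr'_v',
        ← Submodule.inf_orthogonal]
      exact ⟨(sub_mem_moveDir_orthogonal_iff (hr_v'.apply_eq_self hq) p).2 (hrv.apply_eq_self hp),
        (sub_mem_moveDir_orthogonal_iff (hr'_v'.apply_eq_self hq) p).2 (hrv'.apply_eq_self hp)⟩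
    have hs : ∀ x, reflLen n x = 2 → PrefixLE x w → reflLen n (w⁻¹ * x) = 1 := by
      intro x hx hxw
      rw [← reflLen_inv, mul_inv_rev, inv_inv]
      rw [PrefixLE] at hxw
      omega
    have hwp : w⁻¹ p ≠ p := fun h ↦ hw (isElliptic_inv.1 ⟨p, h⟩)
    refine mul_left_cancel (eq_of_reflLen_eq_one (hs v hv hvw) (hs v' hv' hvw') (p := p) ?_ ?_)
    · rw [IsometryEquiv.mul_apply, IsometryEquiv.mul_apply, hp, hp']
    · rwa [IsometryEquiv.mul_apply, hp]
  · have hve' := fun h ↦ hve (hmixed v' v hv hr_v' hr'_v' hrv hrv' h)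
    have h1 := hvw.movSet_subset hve hw (apply_sub_mem_movSet v 0)
    have h2 := hvw'.movSet_subset hve' hw (apply_sub_mem_movSet v' 0)
    have h3 := hrv.apply_sub_mem_moveDir hr hve hv 0
    have h4 := hr_v'.apply_sub_mem_moveDir hr hve' hv' 0
    refine iso_ext_of_linearPart (p := 0)
      ((linearPart_eq_one_of_reflLen_eq_two hve hv).trans
        (linearPart_eq_one_of_reflLen_eq_two hve' hv').symm) ?_
    by_contra hne0
    rw [mem_movSet 0] at h1 h2
    have h5 : v 0 - v' 0 ∈ moveDir w := by simpa using sub_mem h1 h2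
    have h6 : v 0 - v' 0 ∈ moveDir r := by simpa using sub_mem h3 h4
    rw [moveDir_eq_span (reflLen_eq_one.1 hr).2 h6 (sub_ne_zero.2 hne0),
      ← moveDir_eq_span (by omega) h5 (sub_ne_zero.2 hne0)] at h3
    refine hw ((isElliptic_iff_apply_sub_mem 0).2 ?_)
    simpa using sub_mem h3 h1

end Hyperbolic

end Isometries

/-- Lattice failure: the interval `[1,w]` fails to be a lattice iff
`w` is hyperbolic and its move-set has dimension at least `2`; for all other `w` the
interval is a lattice. -/
theorem interval_lattice_iff (n : ℕ) (w : Iso n) :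
    (¬ (∀ u v, inInterval n w u → inInterval n w v →
        (∃ j, inInterval n w j ∧ intervalLE n w u j ∧ intervalLE n w v j ∧
            ∀ j', inInterval n w j' → intervalLE n w u j' → intervalLE n w v j' →
              intervalLE n w j j') ∧
        (∃ m, inInterval n w m ∧ intervalLE n w m u ∧ intervalLE n w m v ∧
            ∀ m', inInterval n w m' → intervalLE n w m' u → intervalLE n w m' v →
              intervalLE n w m' m))) ↔
    ((0 : Euc n) ∉ MovSet n w ∧
      2 ≤ Module.finrank ℝ (vectorSpan ℝ (MovSet n w))) := by
  rw [zero_mem_movSet, vectorSpan_movSet, ← moveDim]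
  constructor
  · intro h
    by_contra hcon
    refine h fun u v hu hv ↦ (hasJoinMeet_iff hu hv).2 ?_
    by_cases hw : IsElliptic w
    · exact hw.hasJoinMeet hu hv
    · have hdim : moveDim w ≤ 1 := by
        by_contra h1
        exact hcon ⟨hw, by omega⟩
      refine hasJoinMeet_of_reflLen_le_three ?_ ?_ hu hv
      · rw [reflLen_of_not_isElliptic hw]
        omega
      · intro r r' v v' hne hr hr' hv hv'
        exact eq_of_bowtie hw hdim hne hr hr' hv hv'
  · rintro ⟨hw, hdim⟩ h
    obtain ⟨r, r', hr, hr', hno⟩ := exists_not_hasJoinMeet hw hdim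
    exact hno ((hasJoinMeet_iff hr hr').1 (h r r' hr hr'))
end
end

section
/- Fix n ≥ 2. Let Art(B_{n+1}) be the group presented by generators s₀, s₁, …, s_n with relations: s₀s₁s₀s₁ = s₁s₀s₁s₀; sᵢs_{i+1}sᵢ = s_{i+1}sᵢs_{i+1} for 1 ≤ i ≤ n−1; and sᵢs_j = s_jsᵢ whenever |i − j| ≥ 2. Let Art(Ã_n) be the group presented by generators t_i indexed by i ∈ ℤ/(n+1) with relations: t_it_{i+1}t_i = t_{i+1}t_it_{i+1} for each i ∈ ℤ/(n+1), and t_it_j = t_jt_i whenever j ≠ i ± 1 in ℤ/(n+1). Then there is a short exact sequence 1 → Art(Ã_n) → Art(B_{n+1}) → ℤ → 1; that is, there exist an injective group homomorphism ι : Art(Ã_n) → Art(B_{n+1}) and a surjective group homomorphism φ : Art(B_{n+1}) → ℤ with ker φ = range ι. -/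
/-- The standard presentation relations for the spherical Artin group
`Art(B_{n+1})` on generators `s₀, …, s_n`:  `s₀s₁s₀s₁ = s₁s₀s₁s₀`;
`sᵢs_{i+1}sᵢ = s_{i+1}sᵢs_{i+1}` for `1 ≤ i ≤ n − 1`; and `sᵢs_j = s_jsᵢ`
whenever `|i − j| ≥ 2`. -/
def relsArtinB (n : ℕ) : Set (FreeGroup (Fin (n + 1))) :=
  {x | ∃ i j : Fin (n + 1), (i : ℕ) = 0 ∧ (j : ℕ) = 1 ∧
      x = FreeGroup.of i * FreeGroup.of j * FreeGroup.of i * FreeGroup.of j *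
        (FreeGroup.of j * FreeGroup.of i * FreeGroup.of j * FreeGroup.of i)⁻¹} ∪
  {x | ∃ i j : Fin (n + 1), (i : ℕ) + 1 = (j : ℕ) ∧ 1 ≤ (i : ℕ) ∧
      x = FreeGroup.of i * FreeGroup.of j * FreeGroup.of i *
        (FreeGroup.of j * FreeGroup.of i * FreeGroup.of j)⁻¹} ∪
  {x | ∃ i j : Fin (n + 1), ((i : ℕ) + 2 ≤ (j : ℕ) ∨ (j : ℕ) + 2 ≤ (i : ℕ)) ∧
      x = FreeGroup.of i * FreeGroup.of j * (FreeGroup.of j * FreeGroup.of i)⁻¹}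

/-- The standard presentation relations for the euclidean Artin group `Art(Ã_n)`
on generators `t_i`, `i ∈ ℤ/(n+1)`:  `t_it_{i+1}t_i = t_{i+1}t_it_{i+1}` for each
`i`, and `t_it_j = t_jt_i` whenever `j ≠ i ± 1`. -/
def relsArtinAtilde (n : ℕ) : Set (FreeGroup (ZMod (n + 1))) :=
  {x | ∃ i : ZMod (n + 1),
      x = FreeGroup.of i * FreeGroup.of (i + 1) * FreeGroup.of i *
        (FreeGroup.of (i + 1) * FreeGroup.of i * FreeGroup.of (i + 1))⁻¹} ∪
  {x | ∃ i j : ZMod (n + 1), j ≠ i + 1 ∧ j ≠ i - 1 ∧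
      x = FreeGroup.of i * FreeGroup.of j * (FreeGroup.of j * FreeGroup.of i)⁻¹}


/-- A sequence whose first `n` terms satisfy the standard relations of the braid group
on `n + 1` strands. -/
structure IsBraidSequence {G : Type*} [Group G] (f : ℕ → G) (n : ℕ) : Prop where
  braid : ∀ i, i + 1 < n → f i * f (i + 1) * f i = f (i + 1) * f i * f (i + 1)
  commute : ∀ i j, i + 2 ≤ j → j < n → Commute (f i) (f j)

/-- The product `f 0 * f 1 * ⋯ * f (n - 1)`. -/
def initialProd {G : Type*} [Group G] (f : ℕ → G) (n : ℕ) : G :=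
  ((List.range n).map f).prod

section InitialProd

variable {G : Type*} [Group G] {f : ℕ → G} {n : ℕ}

theorem initialProd_succ (f : ℕ → G) (n : ℕ) :
    initialProd f (n + 1) = initialProd f n * f n :=
  List.prod_range_succ f n

theorem initialProd_succ' (f : ℕ → G) (n : ℕ) :
    initialProd f (n + 1) = f 0 * initialProd (fun i => f (i + 1)) n :=
  List.prod_range_succ' f n

theorem map_initialProd {H : Type*} [Group H] (φ : G →* H) (f : ℕ → G) (n : ℕ) :
    φ (initialProd f n) = initialProd (fun i => φ (f i)) n := by
  simp [initialProd, map_list_prod, Function.comp_def]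

theorem initialProd_congr {g : ℕ → G} (h : ∀ i < n, f i = g i) :
    initialProd f n = initialProd g n := by
  unfold initialProd
  congr 1
  exact List.map_congr_left fun i hi => h i (List.mem_range.1 hi)

theorem semiconjBy_initialProd {a : G} {g : ℕ → G} (h : ∀ i < n, SemiconjBy a (f i) (g i)) :
    SemiconjBy a (initialProd f n) (initialProd g n) := by
  induction n with
  | zero => exact SemiconjBy.one_right a
  | succ k ih =>
    rw [initialProd_succ, initialProd_succ]
    exact (ih fun i hi => h i (by omega)).mul_right (h k (by omega))

theorem IsBraidSequence.mono {m : ℕ} (hf : IsBraidSequence f n) (hm : m ≤ n) :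
    IsBraidSequence f m :=
  ⟨fun i hi => hf.braid i (by omega), fun i j hij hj => hf.commute i j hij (by omega)⟩

/-- Conjugation by the Coxeter element of a braid group shifts the standard generators. -/
theorem IsBraidSequence.semiconjBy (hf : IsBraidSequence f n) {i : ℕ} (hi : i + 1 < n) :
    SemiconjBy (initialProd f n) (f i) (f (i + 1)) := by
  induction n with
  | zero => omega
  | succ m ih =>
    rw [initialProd_succ]
    rcases Nat.lt_or_ge (i + 1) m with him | him
    · exact (ih (hf.mono (by omega)) him).mul_left (hf.commute i m (by omega) (by omega)).symm
    · obtain rfl : m = i + 1 := by omega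
      have hc : Commute (f (i + 1)) (initialProd f i) :=
        semiconjBy_initialProd fun j hj => (hf.commute j (i + 1) (by omega) (by omega)).symm
      have hb := hf.braid i (by omega)
      rw [initialProd_succ, SemiconjBy]
      calc initialProd f i * f i * f (i + 1) * f i
          = initialProd f i * (f i * f (i + 1) * f i) := by group
        _ = initialProd f i * f (i + 1) * (f i * f (i + 1)) := by rw [hb]; group
        _ = _ := by rw [← hc.eq]; group

/-- The square of the Coxeter element conjugates the last generator to the first one. -/
theorem IsBraidSequence.semiconjBy_sq (hf : IsBraidSequence f (n + 1)) :
    SemiconjBy (initialProd f (n + 1) * initialProd f (n + 1)) (f n) (f 0) := by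
  have h : SemiconjBy (initialProd f (n + 1)) (initialProd f n)
      (initialProd (fun i => f (i + 1)) n) :=
    semiconjBy_initialProd fun i hi => hf.semiconjBy (by omega)
  have h0 := initialProd_succ' f n
  have h1 := initialProd_succ f n
  have e := h.eq
  rw [eq_mul_inv_of_mul_eq h1.symm, eq_inv_mul_of_mul_eq h0.symm] at e
  rw [SemiconjBy]
  have key := congrArg (fun x => f 0 * x * f n) e
  simp only [mul_assoc, mul_inv_cancel_left, inv_mul_cancel, mul_one] at key ⊢
  exact key.symm

/-- In the presence of the other relations of type `B`, the relation of length four says that the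
square of the Coxeter element `a * initialProd f n` conjugates the last generator to `f 0`. -/
theorem IsBraidSequence.four_iff_semiconjBy_sq (hf : IsBraidSequence f (n + 1)) {a : G}
    (ha : ∀ j, 1 ≤ j → j < n + 1 → Commute a (f j)) :
    a * f 0 * a * f 0 = f 0 * a * f 0 * a ↔
      SemiconjBy ((a * initialProd f (n + 1)) * (a * initialProd f (n + 1))) (f n) (f 0) := by
  set d := initialProd f (n + 1)
  set e := initialProd (fun i => f (i + 1)) n
  have hde : d = f 0 * e := initialProd_succ' f n
  have hae : a * e = e * a := Commute.eq <|
    semiconjBy_initialProd fun i hi => ha (i + 1) (by omega) (by omega)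
  have hsq : d * d * f n = f 0 * (d * d) := hf.semiconjBy_sq
  have hed : e * d * f n = d * d := by
    apply mul_left_cancel (a := f 0)
    rw [← hsq, ← mul_assoc, ← mul_assoc, ← hde]
  have hl : a * d * (a * d) * f n = a * f 0 * a * f 0 * (e * d) :=
    calc a * d * (a * d) * f n = a * f 0 * (e * a) * d * f n := by rw [hde]; group
      _ = a * f 0 * a * (e * d * f n) := by rw [← hae]; group
      _ = a * f 0 * a * (f 0 * e * d) := by rw [hed, ← hde]
      _ = _ := by group
  have hr : f 0 * (a * d * (a * d)) = f 0 * a * f 0 * a * (e * d) :=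
    calc f 0 * (a * d * (a * d)) = f 0 * (a * (f 0 * e) * (a * d)) := by rw [← hde]
      _ = f 0 * a * f 0 * (e * a) * d := by group
      _ = _ := by rw [← hae]; group
  rw [SemiconjBy, hl, hr]
  exact ⟨fun h => by rw [h], fun h => mul_right_cancel h⟩

end InitialProd

theorem exists_hom_artinB {G : Type*} [Group G] {n : ℕ} {f : ℕ → G} {a : G}
    (hf : IsBraidSequence f n) (ha : ∀ j, 1 ≤ j → j < n → Commute a (f j))
    (h4 : a * f 0 * a * f 0 = f 0 * a * f 0 * a) :
    ∃ Ψ : PresentedGroup (relsArtinB n) →* G, Ψ (.of 0) = a ∧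
      ∀ i : Fin n, Ψ (.of i.succ) = f i := by
  refine ⟨PresentedGroup.toGroup (f := Fin.cases a fun i => f i) ?_, ?_, fun i => ?_⟩
  · rintro r ((⟨i, j, hi, hj, rfl⟩ | ⟨i, j, hij, hi, rfl⟩) | ⟨i, j, hij, rfl⟩) <;>
      rw [map_mul, map_inv, mul_inv_eq_one] <;>
      simp only [map_mul, FreeGroup.lift_apply_of] <;>
      cases i using Fin.cases <;> cases j using Fin.cases <;>
      simp only [Fin.val_zero, Fin.val_succ, Fin.cases_zero, Fin.cases_succ] at * <;>
      try omega
    · rename_i j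
      rw [show (j : ℕ) = 0 by omega]
      exact h4
    · rename_i i j
      rw [show (j : ℕ) = i + 1 by omega]
      exact hf.braid i (by omega)
    · rename_i j
      exact ha j (by omega) j.2
    · rename_i j
      exact (ha j (by omega) j.2).symm
    · rename_i i j
      rcases hij with h | h
      · exact hf.commute i j (by omega) j.2
      · exact (hf.commute j i (by omega) i.2).symm
  · simp
  · simp

theorem exists_hom_artinAtilde {G : Type*} [Group G] {n : ℕ} {t : ZMod (n + 1) → G}
    (hb : ∀ i, t i * t (i + 1) * t i = t (i + 1) * t i * t (i + 1))
    (hc : ∀ i j, j ≠ i + 1 → j ≠ i - 1 → Commute (t i) (t j)) :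
    ∃ ι : PresentedGroup (relsArtinAtilde n) →* G, ∀ i, ι (.of i) = t i := by
  refine ⟨PresentedGroup.toGroup (f := t) ?_, fun i => PresentedGroup.toGroup.of _⟩
  rintro r (⟨i, rfl⟩ | ⟨i, j, h₁, h₂, rfl⟩) <;> rw [map_mul, map_inv, mul_inv_eq_one] <;>
    simp only [map_mul, FreeGroup.lift_apply_of]
  · exact hb i
  · exact hc i j h₁ h₂

namespace ArtinAtilde

variable {n : ℕ}

theorem braid (i : ZMod (n + 1)) :
    (.of i * .of (i + 1) * .of i : PresentedGroup (relsArtinAtilde n)) =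
      .of (i + 1) * .of i * .of (i + 1) :=
  PresentedGroup.mk_eq_mk_of_mul_inv_mem (Or.inl ⟨i, rfl⟩)

theorem commute {i j : ZMod (n + 1)} (h₁ : j ≠ i + 1) (h₂ : j ≠ i - 1) :
    Commute (.of i : PresentedGroup (relsArtinAtilde n)) (.of j) :=
  PresentedGroup.mk_eq_mk_of_mul_inv_mem (Or.inr ⟨i, j, h₁, h₂, rfl⟩)

theorem exists_rotation (k : ZMod (n + 1)) :
    ∃ σ : PresentedGroup (relsArtinAtilde n) →* PresentedGroup (relsArtinAtilde n),
      ∀ i, σ (.of i) = .of (k + i) := by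
  refine exists_hom_artinAtilde (fun i => ?_) (fun i j h₁ h₂ => commute ?_ ?_)
  · rw [← add_assoc]
    exact braid (k + i)
  · rwa [add_assoc, Ne, add_right_inj]
  · rwa [add_sub_assoc, Ne, add_right_inj]

/-- The endomorphism of `Art(Ã_n)` rotating the generators by `k`. -/
noncomputable def rotation (k : ZMod (n + 1)) :
    PresentedGroup (relsArtinAtilde n) →* PresentedGroup (relsArtinAtilde n) :=
  (exists_rotation k).choose

@[simp]
theorem rotation_of (k i : ZMod (n + 1)) : rotation k (.of i) = .of (k + i) :=
  (exists_rotation k).choose_spec i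

/-- The action of `ℤ` on `Art(Ã_n)` by rotations of the generators. -/
noncomputable def rotationAction (n : ℕ) :
    Multiplicative ℤ →* MulAut (PresentedGroup (relsArtinAtilde n)) where
  toFun k := MonoidHom.toMulEquiv (rotation (k.toAdd : ZMod (n + 1)))
    (rotation (-(k.toAdd : ZMod (n + 1)))) (by ext; simp) (by ext; simp)
  map_one' := by
    apply MulEquiv.toMonoidHom_injective
    ext
    simp
  map_mul' k l := by
    apply MulEquiv.toMonoidHom_injective
    ext
    simp [add_assoc]

@[simp]
theorem rotationAction_of (k : Multiplicative ℤ) (i : ZMod (n + 1)) :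
    rotationAction n k (.of i) = .of ((k.toAdd : ZMod (n + 1)) + i) :=
  rotation_of _ i

theorem isBraidSequence :
    IsBraidSequence
      (fun i => (.of ((i + 1 : ℕ) : ZMod (n + 1)) : PresentedGroup (relsArtinAtilde n))) n where
  braid i _ := by
    have h := braid (n := n) ((i + 1 : ℕ) : ZMod (n + 1))
    rwa [← Nat.cast_succ] at h
  commute i j hij hj := by
    refine commute (fun h => ?_) (fun h => ?_)
    · rw [← Nat.cast_succ, ZMod.natCast_eq_natCast_iff'] at h
      rw [Nat.mod_eq_of_lt (by omega), Nat.mod_eq_of_lt (by omega)] at h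
      omega
    · rw [eq_sub_iff_add_eq, ← Nat.cast_succ, ZMod.natCast_eq_natCast_iff'] at h
      rcases Nat.lt_or_ge (j + 2) (n + 1) with h' | h'
      · rw [Nat.mod_eq_of_lt (by omega), Nat.mod_eq_of_lt (by omega)] at h
        omega
      · rw [show (j + 1).succ = n + 1 by omega, Nat.mod_self, Nat.mod_eq_of_lt (by omega)] at h
        omega

end ArtinAtilde

section TypeB

variable {G : Type*} [Group G] {n : ℕ} {f : ℕ → G} {a : G}

/-- From generators of type `B_{n+1}`, one obtains generators of type `Ã_n`, cyclically permuted by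
the Coxeter element. -/
theorem exists_hom_artinAtilde_of_typeB (hn : 2 ≤ n) (hf : IsBraidSequence f n)
    (ha : ∀ j, 1 ≤ j → j < n → Commute a (f j))
    (h4 : a * f 0 * a * f 0 = f 0 * a * f 0 * a) :
    ∃ ι : PresentedGroup (relsArtinAtilde n) →* G, (∀ m : ℤ,
      ι (.of (m : ZMod (n + 1))) = MulAut.conj ((a * initialProd f n) ^ (m - 1)) (f 0)) ∧
      ∀ i < n, ι (.of ((i + 1 : ℕ) : ZMod (n + 1))) = f i := by
  set τ := a * initialProd f n
  obtain ⟨c, hc⟩ : ∃ c : ℤ → G, ∀ m, c m = MulAut.conj (τ ^ (m - 1)) (f 0) := ⟨_, fun _ => rfl⟩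
  simp only [← hc]
  have hconj : ∀ k m, MulAut.conj (τ ^ k) (c m) = c (k + m) := fun k m => by
    rw [hc, hc, ← MulAut.mul_apply, ← map_mul, ← zpow_add, add_sub_assoc]
  have hshift : ∀ i, i + 1 < n → τ * f i * τ⁻¹ = f (i + 1) := fun i hi =>
    mul_inv_eq_of_eq_mul (SemiconjBy.mul_left (ha (i + 1) (by omega) hi) (hf.semiconjBy hi)).eq
  have hcf : ∀ i : ℕ, i < n → c (i + 1) = f i := by
    intro i hi
    induction i with
    | zero => simp [hc]
    | succ i ih =>
      rw [← hshift i hi, ← ih (by omega), ← MulAut.conj_apply, ← zpow_one τ, hconj]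
      congr 1
      push_cast
      ring
  have hper : Function.Periodic c ((n + 1 : ℕ) : ℤ) := by
    intro m
    obtain ⟨k, rfl⟩ : ∃ k, n = k + 1 := ⟨n - 1, by omega⟩
    have h := ((hf.four_iff_semiconjBy_sq ha).1 h4).eq
    have h1 : MulAut.conj (τ ^ (2 : ℤ)) (f k) = f 0 := by
      rw [MulAut.conj_apply, zpow_two]
      exact mul_inv_eq_of_eq_mul h
    rw [← hcf k (by omega), hconj, ← hcf 0 (by omega)] at h1
    have h2 := congrArg (MulAut.conj (τ ^ (m - 1))) h1
    rw [hconj, hconj] at h2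
    convert h2 using 2 <;> push_cast <;> ring
  have hcast : ∀ m : ℤ, c ((m : ZMod (n + 1)).val) = c m := fun m => by
    rw [ZMod.val_intCast, Int.emod_def, mul_comm]
    exact hper.sub_int_mul_eq _
  have hind : ∀ i : ZMod (n + 1), ∃ m : ℤ, i = m := fun i => ⟨i.val, by simp⟩
  obtain ⟨ι, hι⟩ : ∃ ι : PresentedGroup (relsArtinAtilde n) →* G, ∀ i, ι (.of i) = c i.val := by
    refine exists_hom_artinAtilde (t := fun i => c i.val) ?_ ?_
    · intro i
      obtain ⟨m, rfl⟩ := hind i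
      rw [← Int.cast_one, ← Int.cast_add, hcast, hcast]
      have h := hf.braid 0 (by omega)
      rw [← hcf 0 (by omega), ← hcf 1 (by omega)] at h
      have h' := congrArg (MulAut.conj (τ ^ (m - 1))) h
      have e₀ : m - 1 + ((0 : ℕ) + 1) = m := by simp
      have e₁ : m - 1 + ((0 + 1 : ℕ) + 1) = m + 1 := by push_cast; ring
      simp only [map_mul, hconj] at h'
      rwa [e₀, e₁] at h'
    · intro i j h₁ h₂
      obtain ⟨m, rfl⟩ := hind i
      obtain ⟨e, he, rfl⟩ : ∃ e : ℕ, e < n + 1 ∧ j = ((m + e : ℤ) : ZMod (n + 1)) :=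
        ⟨(j - m).val, ZMod.val_lt _, by simp⟩
      rw [hcast, hcast]
      rcases Nat.eq_zero_or_pos e with rfl | he0
      · simp
      have he1 : e ≠ 1 := by
        rintro rfl
        simp at h₁
      have hen : e ≠ n := by
        rintro rfl
        apply h₂
        have : ((e + 1 : ℕ) : ZMod (e + 1)) = 0 := ZMod.natCast_self _
        push_cast at this ⊢
        linear_combination this
      have h := hf.commute 0 e (by omega) (by omega)
      rw [← hcf 0 (by omega), ← hcf e (by omega)] at h
      have h' := h.map (MulAut.conj (τ ^ (m - 1)))
      rw [hconj, hconj] at h'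
      convert h' using 2 <;> push_cast <;> ring
  refine ⟨ι, fun m => by rw [hι, hcast], fun i hi => ?_⟩
  rw [← hcf i hi, ← Int.cast_natCast, hι, hcast, Nat.cast_succ]

end TypeB

namespace ArtinB

variable {n : ℕ}

theorem four {i j : Fin (n + 1)} (hi : (i : ℕ) = 0) (hj : (j : ℕ) = 1) :
    (.of i * .of j * .of i * .of j : PresentedGroup (relsArtinB n)) =
      .of j * .of i * .of j * .of i :=
  PresentedGroup.mk_eq_mk_of_mul_inv_mem (Or.inl (Or.inl ⟨i, j, hi, hj, rfl⟩))

theorem braid {i j : Fin (n + 1)} (hij : (i : ℕ) + 1 = j) (hi : 1 ≤ (i : ℕ)) :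
    (.of i * .of j * .of i : PresentedGroup (relsArtinB n)) = .of j * .of i * .of j :=
  PresentedGroup.mk_eq_mk_of_mul_inv_mem (Or.inl (Or.inr ⟨i, j, hij, hi, rfl⟩))

theorem commute {i j : Fin (n + 1)} (h : (i : ℕ) + 2 ≤ j) :
    Commute (.of i : PresentedGroup (relsArtinB n)) (.of j) :=
  PresentedGroup.mk_eq_mk_of_mul_inv_mem (Or.inr ⟨i, j, Or.inl h, rfl⟩)

/-- The generators `s₁, s₂, …` of `Art(B_{n+1})`, indexed from `0`. -/
def braidGen (n i : ℕ) : PresentedGroup (relsArtinB n) :=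
  .of (Fin.ofNat (n + 1) (i + 1))

theorem val_ofNat_succ {i : ℕ} (hi : i < n) : (Fin.ofNat (n + 1) (i + 1) : ℕ) = i + 1 :=
  Nat.mod_eq_of_lt (by omega)

theorem of_succ (i : Fin n) :
    (.of i.succ : PresentedGroup (relsArtinB n)) = braidGen n i := by
  unfold braidGen
  congr 1
  ext
  rw [val_ofNat_succ i.2, Fin.val_succ]

theorem isBraidSequence : IsBraidSequence (braidGen n) n where
  braid i hi := braid (by rw [val_ofNat_succ, val_ofNat_succ] <;> omega)
    (by rw [val_ofNat_succ] <;> omega)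
  commute i j hij hj := commute (by rw [val_ofNat_succ, val_ofNat_succ] <;> omega)

theorem commute_zero (j : ℕ) (hj : 1 ≤ j) (hjn : j < n) :
    Commute (.of 0 : PresentedGroup (relsArtinB n)) (braidGen n j) :=
  commute (by rw [val_ofNat_succ hjn, Fin.val_zero]; omega)

theorem four_zero (hn : 1 ≤ n) :
    (.of 0 * braidGen n 0 * .of 0 * braidGen n 0 : PresentedGroup (relsArtinB n)) =
      braidGen n 0 * .of 0 * braidGen n 0 * .of 0 :=
  four rfl (val_ofNat_succ hn)

/-- The Coxeter element `s₀ s₁ ⋯ s_n` of `Art(B_{n+1})`. -/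
def coxeterElement (n : ℕ) : PresentedGroup (relsArtinB n) :=
  .of 0 * initialProd (braidGen n) n

end ArtinB

namespace ArtinAtilde

open SemidirectProduct ArtinB

variable {n : ℕ}

/-- The `i`-th generator of `Art(Ã_n)` in `Art(Ã_n) ⋊ ℤ`, indexed from `0`. -/
noncomputable def inlGen (n i : ℕ) :
    PresentedGroup (relsArtinAtilde n) ⋊[rotationAction n] Multiplicative ℤ :=
  inl (.of ((i + 1 : ℕ) : ZMod (n + 1)))

theorem conj_inr_inl (k : ℤ) (i : ZMod (n + 1)) :
    (MulAut.conj (inr (.ofAdd k)) (inl (.of i)) :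
      PresentedGroup (relsArtinAtilde n) ⋊[rotationAction n] Multiplicative ℤ) =
      inl (.of (k + i)) := by
  rw [MulAut.conj_apply, ← map_inv, ← inl_aut, rotationAction_of, toAdd_ofAdd]

theorem semiconjBy_inr_inl (k : ℤ) (i j : ZMod (n + 1)) (h : k + i = j) :
    SemiconjBy (inr (.ofAdd k) :
      PresentedGroup (relsArtinAtilde n) ⋊[rotationAction n] Multiplicative ℤ)
      (inl (.of i)) (inl (.of j)) := by
  rw [← h, ← conj_inr_inl]
  exact SemiconjBy.conj_mk _ _

theorem isBraidSequence_inlGen : IsBraidSequence (inlGen n) n where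
  braid i hi := by
    have h := congrArg (inl (φ := rotationAction n)) (isBraidSequence.braid i hi)
    simp only [map_mul] at h
    exact h
  commute i j hij hj := (isBraidSequence.commute i j hij hj).map inl

theorem exists_hom_semidirectProduct (hn : 2 ≤ n) :
    ∃ Ψ : PresentedGroup (relsArtinB n) →*
        PresentedGroup (relsArtinAtilde n) ⋊[rotationAction n] Multiplicative ℤ,
      Ψ (.of 0) = inr (.ofAdd 1) * (initialProd (inlGen n) n)⁻¹ ∧
      ∀ i < n, Ψ (braidGen n i) = inlGen n i := by
  have hf := isBraidSequence_inlGen (n := n)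
  have ha : ∀ j, 1 ≤ j → j < n →
      Commute (inr (.ofAdd 1) * (initialProd (inlGen n) n)⁻¹) (inlGen n j) := by
    intro j hj hjn
    obtain ⟨i, rfl⟩ : ∃ i, j = i + 1 := ⟨j - 1, by omega⟩
    refine SemiconjBy.mul_left (y := inlGen n i) ?_ (hf.semiconjBy hjn).inv_symm_left
    apply semiconjBy_inr_inl
    push_cast
    ring
  have h4 : inr (.ofAdd 1) * (initialProd (inlGen n) n)⁻¹ * inlGen n 0 *
      (inr (.ofAdd 1) * (initialProd (inlGen n) n)⁻¹) * inlGen n 0 =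
      inlGen n 0 * (inr (.ofAdd 1) * (initialProd (inlGen n) n)⁻¹) * inlGen n 0 *
      (inr (.ofAdd 1) * (initialProd (inlGen n) n)⁻¹) := by
    obtain ⟨m, rfl⟩ : ∃ m, n = m + 1 := ⟨n - 1, by omega⟩
    rw [hf.four_iff_semiconjBy_sq ha, inv_mul_cancel_right, ← map_mul, ← ofAdd_add]
    apply semiconjBy_inr_inl
    have : ((m + 1 + 1 : ℕ) : ZMod (m + 1 + 1)) = 0 := ZMod.natCast_self _
    push_cast at this ⊢
    linear_combination this
  obtain ⟨Ψ, h0, hΨ⟩ := exists_hom_artinB hf ha h4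
  exact ⟨Ψ, h0, fun i hi => by simpa only [of_succ] using hΨ ⟨i, hi⟩⟩

end ArtinAtilde

open SemidirectProduct ArtinB ArtinAtilde in
/-- there is a short exact sequence
`1 → Art(Ã_n) → Art(B_{n+1}) → ℤ → 1`: an injective homomorphism
`ι : Art(Ã_n) → Art(B_{n+1})` and a surjective homomorphism
`φ : Art(B_{n+1}) → ℤ` with `ker φ = range ι`. -/
theorem artinAtilde_ses (n : ℕ) (hn : 2 ≤ n) :
    ∃ (ι : PresentedGroup (relsArtinAtilde n) →* PresentedGroup (relsArtinB n))
      (φ : PresentedGroup (relsArtinB n) →* Multiplicative ℤ),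
      Function.Injective ι ∧ Function.Surjective φ ∧ φ.ker = ι.range := by
  obtain ⟨ι, hι, hιgen⟩ := exists_hom_artinAtilde_of_typeB hn ArtinB.isBraidSequence commute_zero
    (four_zero (by omega))
  change ∀ m : ℤ, _ = MulAut.conj (coxeterElement n ^ (m - 1)) _ at hι
  obtain ⟨Ψ, hΨ0, hΨ⟩ := exists_hom_semidirectProduct hn
  have hΨτ : Ψ (coxeterElement n) = inr (.ofAdd 1) := by
    rw [coxeterElement, map_mul, hΨ0, map_initialProd, initialProd_congr hΨ,
      inv_mul_cancel_right]
  have hτ : ∀ k : ℤ, (inr (.ofAdd 1) ^ k :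
      PresentedGroup (relsArtinAtilde n) ⋊[rotationAction n] Multiplicative ℤ) =
      inr (.ofAdd k) := fun k => by
    rw [← map_zpow, ← ofAdd_zsmul, smul_eq_mul, mul_one]
  have hind : ∀ i : ZMod (n + 1), ∃ m : ℤ, i = m := fun i => ⟨i.val, by simp⟩
  have hΨι : Ψ.comp ι = inl := by
    refine PresentedGroup.ext fun i => ?_
    obtain ⟨m, rfl⟩ := hind i
    rw [MonoidHom.comp_apply, hι, MulAut.conj_apply, map_mul, map_mul, map_inv, map_zpow, hΨτ, hτ,
      hΨ 0 (by omega), ← MulAut.conj_apply, inlGen, conj_inr_inl]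
    push_cast
    simp
  let Φ : PresentedGroup (relsArtinAtilde n) ⋊[rotationAction n] Multiplicative ℤ →*
      PresentedGroup (relsArtinB n) :=
    SemidirectProduct.lift ι (zpowersHom _ (coxeterElement n)) <| by
      intro k
      ext i
      obtain ⟨m, rfl⟩ := hind i
      change ι (rotationAction n k (.of _)) =
        MulAut.conj (coxeterElement n ^ k.toAdd) (ι (.of _))
      rw [rotationAction_of, ← Int.cast_add, hι, hι, ← MulAut.mul_apply, ← map_mul, ← zpow_add,
        add_sub_assoc]
  have hΦgen : ∀ i < n, Φ (inlGen n i) = braidGen n i := fun i hi => (lift_inl ..).trans (hιgen i hi)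
  have hΦΨ : Φ.comp Ψ = MonoidHom.id _ := by
    ext j
    cases j using Fin.cases with
    | zero =>
      rw [MonoidHom.comp_apply, hΨ0, map_mul, map_inv, map_initialProd, initialProd_congr hΦgen]
      simp [Φ, coxeterElement]
    | succ i =>
      rw [MonoidHom.comp_apply, of_succ, hΨ i i.2, hΦgen i i.2, MonoidHom.id_apply]
  have hφτ : (rightHom.comp Ψ) (coxeterElement n) = .ofAdd 1 := by
    rw [MonoidHom.comp_apply, hΨτ, rightHom_inr]
  refine ⟨ι, rightHom.comp Ψ, ?_, fun k => ⟨coxeterElement n ^ k.toAdd, ?_⟩, ?_⟩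
  · refine Function.Injective.of_comp (f := Ψ) ?_
    rw [← MonoidHom.coe_comp, hΨι]
    exact inl_injective
  · rw [map_zpow, hφτ, ← ofAdd_zsmul, smul_eq_mul, mul_one, ofAdd_toAdd]
  · rw [← MonoidHom.comap_ker, ← range_inl_eq_ker_rightHom]
    ext b
    constructor
    · rintro ⟨a, ha⟩
      refine ⟨a, ?_⟩
      have h := congrArg Φ ha
      rwa [lift_inl, ← MonoidHom.comp_apply, hΦΨ] at h
    · rintro ⟨a, rfl⟩
      exact ⟨a, (DFunLike.congr_fun hΨι a).symm⟩
end
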